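/- arXiv:math/0108057 — 12 statements merged into one kernel-verified Lean document; each statement's English description precedes it below -/
import Mathlib

section
/- Let H be a complex Hilbert space and let A, B ∈ B(H). If A is positive and AB + BA = 0, then AB = BA = 0. -/
open scoped ComplexOrder

/-- **Lemma 3.** If `A, B` are bounded operators on a complex Hilbert space with
`A` positive and `AB + BA = 0`, then `AB = BA = 0`. -/
theorem positive_anticommute_implies_zero
    {H : Type*} [NormedAddCommGroup H] [InnerProductSpace ℂ H] [CompleteSpace H]
    (A B : H →L[ℂ] H) (hA : ∀ x : H, 0 ≤ (inner ℂ (A x) x : ℂ))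
    (h : A * B + B * A = 0) : A * B = 0 ∧ B * A = 0 := by
  have hpos : 0 ≤ A := by
    rw [ContinuousLinearMap.nonneg_iff_isPositive, ContinuousLinearMap.isPositive_iff_complex]
    intro x
    have hx := Complex.le_def.1 (hA x)
    refine ⟨Complex.ext ?_ ?_, ?_⟩
    · simp
    · simpa using hx.2
    · simpa using hx.1
  have h1 : A * B = -(B * A) := eq_neg_of_add_eq_zero_left h
  have hc : Commute (A * A) B := by
    change A * A * B = B * (A * A)
    rw [mul_assoc, h1, mul_neg, ← mul_assoc, h1, neg_mul, neg_neg, mul_assoc]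
  have hs : Commute (CFC.sqrt (A * A)) B := hc.cfcₙ_nnreal _
  rw [CFC.sqrt_mul_self A hpos] at hs
  have h2 : A * B = B * A := hs
  have h3 : A * B = 0 := by
    rw [← h2, ← two_smul ℂ] at h
    exact (smul_eq_zero.1 h).resolve_left two_ne_zero
  exact ⟨h3, h2 ▸ h3⟩
end

section
/- Let 𝒜 be a standard operator algebra on a complex Hilbert space H, and let A, B ∈ 𝒜 be self-adjoint. Then the closure of the range of A is contained in the closure of the range of B if and only if for every positive operator C ∈ 𝒜 with BC = 0 it follows that AC = 0. -/
open scoped ComplexOrder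

theorem closure_range_eq_orthogonal_ker
    {H : Type*} [NormedAddCommGroup H] [InnerProductSpace ℂ H] [CompleteSpace H]
    (T : H →L[ℂ] H) (hT : IsSelfAdjoint T) :
    closure (Set.range T) = ((T.kerᗮ : Submodule ℂ H) : Set H) := by
  rw [ContinuousLinearMap.orthogonal_ker, hT.adjoint_eq, Submodule.topologicalClosure_coe]
  rfl

/-- **Lemma 4.** For self-adjoint elements `A, B` of a standard operator algebra on a
complex Hilbert space, `closure (rng A) ⊆ closure (rng B)` holds iff every positive
`C` in the algebra with `BC = 0` satisfies `AC = 0`. -/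
theorem range_closure_subset_iff_annihilation
    {H : Type*} [NormedAddCommGroup H] [InnerProductSpace ℂ H] [CompleteSpace H]
    (𝒜 : NonUnitalSubalgebra ℂ (H →L[ℂ] H))
    (h𝒜 : ∀ T : H →L[ℂ] H, FiniteDimensional ℂ (LinearMap.range (T : H →ₗ[ℂ] H)) → T ∈ 𝒜)
    (A B : H →L[ℂ] H) (hA𝒜 : A ∈ 𝒜) (hB𝒜 : B ∈ 𝒜)
    (hA : IsSelfAdjoint A) (hB : IsSelfAdjoint B) :
    closure (Set.range A) ⊆ closure (Set.range B) ↔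
      ∀ C : H →L[ℂ] H, C ∈ 𝒜 → (∀ x : H, 0 ≤ (inner ℂ (C x) x : ℂ)) →
        B * C = 0 → A * C = 0 := by
  rw [closure_range_eq_orthogonal_ker A hA, closure_range_eq_orthogonal_ker B hB,
    SetLike.coe_subset_coe]
  constructor
  · intro h C _ _ hBC
    ext x
    have hx : B (C x) = 0 := by simpa using congrArg (fun T : H →L[ℂ] H => T x) hBC
    have h1 : A (A (C x)) ∈ A.kerᗮ := by
      rw [← SetLike.mem_coe, ← closure_range_eq_orthogonal_ker A hA]
      exact subset_closure ⟨_, rfl⟩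
    have h2 : inner ℂ (C x) (A (A (C x))) = 0 :=
      (Submodule.mem_orthogonal _ _).1 (h h1) (C x) hx
    have h3 : inner ℂ (A (C x)) (A (C x)) = 0 := by
      have h4 := ContinuousLinearMap.adjoint_inner_left A (A (C x)) (C x)
      rw [hA.adjoint_eq] at h4
      rw [h4, h2]
    simpa using h3
  · intro h
    apply Submodule.orthogonal_le
    intro x hx
    have hBx : B x = 0 := hx
    have h0 := h (InnerProductSpace.rankOne ℂ x x) (h𝒜 _ ?_) ?_ ?_
    · have h1 : A (inner ℂ x x • x) = 0 := by
        simpa using congrArg (fun T : H →L[ℂ] H => T x) h0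
      rw [map_smul, smul_eq_zero, inner_self_eq_zero] at h1
      show A x = 0
      rcases h1 with h1 | h1
      · rw [h1, map_zero]
      · exact h1
    · have hle : LinearMap.range ((InnerProductSpace.rankOne ℂ x x : H →L[ℂ] H) : H →ₗ[ℂ] H)
          ≤ Submodule.span ℂ {x} := by
        rintro _ ⟨y, rfl⟩
        exact Submodule.smul_mem _ _ (Submodule.mem_span_singleton_self x)
      exact Submodule.finiteDimensional_of_le hle
    · intro y
      exact (InnerProductSpace.isPositive_rankOne_self (𝕜 := ℂ) x).inner_nonneg_left y
    · ext y
      simp [hBx]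
end

section
/- Let H be a complex Hilbert space. If A ∈ B(H) is such that TA + AT ≥ 0 holds for every positive finite rank operator T ∈ F(H), then A is a nonnegative scalar multiple of the identity operator. -/
open scoped ComplexOrder

lemma aux_key {p d : ℂ} (h : ∀ s : ℝ, 0 ≤ (s : ℂ) * p + (s : ℂ) ^ 2 * d) : p = 0 := by
  have hre : ∀ s : ℝ, 0 ≤ d.re * (s * s) + p.re * s + 0 := by
    intro s
    have := (Complex.le_def.1 (h s)).1
    simp [← Complex.ofReal_pow] at this
    nlinarith
  have him : ∀ s : ℝ, 0 = s * p.im + s ^ 2 * d.im := by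
    intro s
    have := (Complex.le_def.1 (h s)).2
    simpa [← Complex.ofReal_pow] using this
  have h1 := discrim_le_zero hre
  unfold discrim at h1
  have h2 := him 1
  have h3 := him (-1)
  apply Complex.ext
  · simp only [Complex.zero_re]
    nlinarith [sq_nonneg p.re]
  · simp only [Complex.zero_im]
    nlinarith

/-- **Lemma 5.** If `A ∈ B(H)` is such that `TA + AT ≥ 0` for every positive finite
rank operator `T`, then `A` is a nonnegative scalar multiple of the identity. -/
theorem nonnegative_scalar_of_positive_anticommutators
    {H : Type*} [NormedAddCommGroup H] [InnerProductSpace ℂ H] [CompleteSpace H]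
    (A : H →L[ℂ] H)
    (h : ∀ T : H →L[ℂ] H, FiniteDimensional ℂ (LinearMap.range (T : H →ₗ[ℂ] H)) →
      (∀ x : H, 0 ≤ (inner ℂ (T x) x : ℂ)) →
      ∀ x : H, 0 ≤ (inner ℂ ((T * A + A * T) x) x : ℂ)) :
    ∃ c : ℝ, 0 ≤ c ∧ A = (c : ℂ) • (1 : H →L[ℂ] H) := by
  have key : ∀ x y : H, 0 ≤ (inner ℂ (A x) y * inner ℂ y x + inner ℂ x y * inner ℂ (A y) x : ℂ) := by
    intro x y
    have h1 := h ((innerSL ℂ y).smulRight y) ?_ ?_ x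
    · simpa [inner_add_left, inner_smul_left, mul_comm] using h1
    · have hle : LinearMap.range (((innerSL ℂ y).smulRight y : H →L[ℂ] H) : H →ₗ[ℂ] H)
          ≤ Submodule.span ℂ {y} := by
        rintro _ ⟨w, rfl⟩
        exact Submodule.smul_mem _ _ (Submodule.mem_span_singleton_self y)
      exact Submodule.finiteDimensional_of_le hle
    · intro w
      simp only [ContinuousLinearMap.smulRight_apply, innerSL_apply_apply, inner_smul_left]
      exact star_mul_self_nonneg (inner ℂ y w : ℂ)
  have orth : ∀ y z : H, y ≠ 0 → inner ℂ y z = 0 → (inner ℂ (A y) z : ℂ) = 0 := by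
    intro y z hy hz
    have hz' : (inner ℂ z y : ℂ) = 0 := inner_eq_zero_symm.1 hz
    have hN : (inner ℂ y y : ℂ) ≠ 0 := inner_self_ne_zero.2 hy
    have hu : ∀ u : ℂ, inner ℂ y y * (inner ℂ (A z) y * u
        + inner ℂ (A y) z * (starRingEnd ℂ) u : ℂ) = 0 := by
      intro u
      apply aux_key (d := inner ℂ y y * (2 * (u * (starRingEnd ℂ) u) * inner ℂ (A y) y))
      intro s
      have := key (z + ((s : ℂ) * u) • y) y
      simp only [map_add, map_smul, inner_add_left, inner_add_right, inner_smul_left,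
        inner_smul_right, hz, hz', map_mul, Complex.conj_ofReal] at this
      convert this using 1
      ring
    have h1 := (mul_eq_zero.1 (hu 1)).resolve_left hN
    have h2 := (mul_eq_zero.1 (hu Complex.I)).resolve_left hN
    simp only [map_one, Complex.conj_I] at h1 h2
    have h3 : (inner ℂ (A z) y - inner ℂ (A y) z : ℂ) * Complex.I = 0 := by
      rw [← h2]; ring
    have h4 := (mul_eq_zero.1 h3).resolve_right Complex.I_ne_zero
    linear_combination (h1 - h4) / 2
  have eig : ∀ y : H, ∃ c : ℂ, A y = c • y := by
    intro y
    by_cases hy : y = 0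
    · exact ⟨0, by simp [hy]⟩
    have hN : (inner ℂ y y : ℂ) ≠ 0 := inner_self_ne_zero.2 hy
    set c : ℂ := inner ℂ y (A y) / inner ℂ y y with hc
    refine ⟨c, ?_⟩
    have hz : (inner ℂ y (A y - c • y) : ℂ) = 0 := by
      rw [inner_sub_right, inner_smul_right, hc, div_mul_cancel₀ _ hN, sub_self]
    have h2 := orth y _ hy hz
    rw [← sub_eq_zero, ← inner_self_eq_zero (𝕜 := ℂ), inner_sub_left, h2, inner_smul_left, hz]
    simp
  by_cases hH : ∀ y : H, y = 0
  · refine ⟨0, le_rfl, ?_⟩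
    ext y
    rw [hH y]; simp
  push Not at hH
  obtain ⟨y, hy⟩ := hH
  obtain ⟨c, hc⟩ := eig y
  have hN : (inner ℂ y y : ℂ) ≠ 0 := inner_self_ne_zero.2 hy
  have hall : ∀ z, A z = c • z := by
    have orth2 : ∀ z, inner ℂ y z = 0 → A z = c • z := by
      intro z hz
      obtain ⟨a, ha⟩ := eig z
      obtain ⟨b, hb⟩ := eig (y + z)
      have hz' : (inner ℂ z y : ℂ) = 0 := inner_eq_zero_symm.1 hz
      rw [map_add, hc, ha] at hb
      have h1 := congrArg (fun w => (inner ℂ y w : ℂ)) hb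
      have h2 := congrArg (fun w => (inner ℂ z w : ℂ)) hb
      simp only [inner_add_right, inner_smul_right, hz, hz', mul_zero, add_zero, zero_add] at h1 h2
      have h3 := mul_right_cancel₀ hN h1
      by_cases hz0 : z = 0
      · simp [hz0]
      have h4 := mul_right_cancel₀ (inner_self_ne_zero.2 hz0) h2
      rw [ha, h4, h3]
    intro z
    have h1 := orth2 (z - ((inner ℂ y z : ℂ) / inner ℂ y y) • y) (by
      rw [inner_sub_right, inner_smul_right, div_mul_cancel₀ _ hN, sub_self])
    rw [map_sub, map_smul, hc, smul_sub, smul_comm] at h1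
    exact sub_left_injective h1
  have h1 := key y y
  have hn : (inner ℂ y y : ℂ) = ((‖y‖ ^ 2 : ℝ) : ℂ) := by
    simp [inner_self_eq_norm_sq_to_K]
  have hp : 0 < ‖y‖ ^ 2 := by positivity
  rw [hc, inner_smul_left, hn] at h1
  generalize ‖y‖ ^ 2 = r at h1 hp
  have h2 := Complex.le_def.1 h1
  simp at h2
  have hrr : 0 < r * r := by positivity
  have him : c.im = 0 := by
    have := h2.2
    have : r * r * c.im = 0 := by linarith
    exact (mul_eq_zero.1 this).resolve_left hrr.ne'
  refine ⟨c.re, ?_, ?_⟩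
  · by_contra hneg
    push Not at hneg
    nlinarith [h2.1, mul_pos hrr (neg_pos.2 hneg)]
  · have : (c.re : ℂ) = c := Complex.ext (by simp) (by simp [him])
    ext z
    simp [this, hall z]
end

section
/- Let X and Y be complex Banach spaces with dim X > 1, let 𝒜 ⊆ B(X) and ℬ ⊆ B(Y) be standard operator algebras, and let φ : 𝒜 → ℬ be a bijective transformation satisfying φ((1/2)(AB+BA)) = (1/2)(φ(A)φ(B)+φ(B)φ(A)) for all A, B ∈ 𝒜. Then φ preserves orthogonality between idempotents in both directions: for all idempotents P, Q ∈ 𝒜, PQ = QP = 0 if and only if φ(P)φ(Q) = φ(Q)φ(P) = 0. -/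
/-- Idempotents whose Jordan product vanishes are orthogonal. -/
theorem orth_of_jordan_zero {R : Type*} [NonUnitalRing R] [Module ℂ R] {p q : R}
    (hp : p * p = p) (h : p * q + q * p = 0) : p * q = 0 ∧ q * p = 0 := by
  have h1 : p * q + p * q * p = 0 := by
    have := congrArg (fun x => p * x) h
    simpa [mul_add, ← mul_assoc, hp] using this
  have h2 : p * q * p + q * p = 0 := by
    have := congrArg (fun x => x * p) h
    simpa [add_mul, mul_assoc, hp] using this
  have h3 : p * q = q * p := by
    rw [eq_neg_of_add_eq_zero_left h1, eq_neg_of_add_eq_zero_right h2]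
  have h4 : p * q = 0 := by
    rw [← h3, ← two_smul ℂ] at h
    exact (smul_eq_zero_iff_right (two_ne_zero)).1 h
  exact ⟨h4, h3 ▸ h4⟩

theorem jordan_map_preserves_orthogonality_of_idempotents
    {X Y : Type*} [NormedAddCommGroup X] [NormedSpace ℂ X] [CompleteSpace X]
    [NormedAddCommGroup Y] [NormedSpace ℂ Y] [CompleteSpace Y]
    (hX : 1 < Module.rank ℂ X)
    (𝒜 : NonUnitalSubalgebra ℂ (X →L[ℂ] X)) (ℬ : NonUnitalSubalgebra ℂ (Y →L[ℂ] Y))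
    (h𝒜 : ∀ T : X →L[ℂ] X, FiniteDimensional ℂ (LinearMap.range (T : X →ₗ[ℂ] X)) → T ∈ 𝒜)
    (hℬ : ∀ S : Y →L[ℂ] Y, FiniteDimensional ℂ (LinearMap.range (S : Y →ₗ[ℂ] Y)) → S ∈ ℬ)
    (φ : 𝒜 → ℬ) (hbij : Function.Bijective φ)
    (hJ : ∀ A B : 𝒜, φ (((1:ℂ)/2) • (A * B + B * A))
        = ((1:ℂ)/2) • (φ A * φ B + φ B * φ A)) :
    ∀ P Q : 𝒜, P * P = P → Q * Q = Q →
      ((P * Q = 0 ∧ Q * P = 0) ↔ (φ P * φ Q = 0 ∧ φ Q * φ P = 0)) := by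
  have hhalf : ((1:ℂ)/2) ≠ 0 := by norm_num
  have h0 : φ 0 = 0 := by
    obtain ⟨A, hA⟩ := hbij.2 0
    have := hJ 0 A
    simpa [hA] using this
  have hid : ∀ P : 𝒜, P * P = P → φ P * φ P = φ P := by
    intro P hP
    have h := hJ P P
    rw [hP, ← two_smul ℂ P, ← two_smul ℂ (φ P * φ P), smul_smul, smul_smul] at h
    norm_num at h
    exact h.symm
  intro P Q hP hQ
  constructor
  · rintro ⟨h1, h2⟩
    have h := hJ P Q
    rw [h1, h2, add_zero, smul_zero, h0] at h
    exact orth_of_jordan_zero (hid P hP) ((smul_eq_zero_iff_right hhalf).1 h.symm)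
  · rintro ⟨h1, h2⟩
    have h := hJ P Q
    rw [h1, h2, add_zero, smul_zero, ← h0] at h
    exact orth_of_jordan_zero hP ((smul_eq_zero_iff_right hhalf).1 (hbij.1 h))
end

section
/- Let X and Y be complex Banach spaces with dim X > 1, let 𝒜 ⊆ B(X) and ℬ ⊆ B(Y) be standard operator algebras, and let φ : 𝒜 → ℬ be a bijective transformation satisfying φ((1/2)(AB+BA)) = (1/2)(φ(A)φ(B)+φ(B)φ(A)) for all A, B ∈ 𝒜. Then φ preserves the partial order between idempotents: for all idempotents P, Q ∈ 𝒜 with P ≤ Q (i.e. PQ = QP = P), one has φ(P) ≤ φ(Q) (i.e. φ(P)φ(Q) = φ(Q)φ(P) = φ(P)). -/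
theorem jordan_half_smul_add_self {Z : Type*} [AddCommGroup Z] [Module ℂ Z] (z : Z) :
    ((1:ℂ)/2) • (z + z) = z := by
  rw [← two_smul ℂ z, smul_smul]
  norm_num

theorem jordan_map_preserves_order_of_idempotents
    {X Y : Type*} [NormedAddCommGroup X] [NormedSpace ℂ X] [CompleteSpace X]
    [NormedAddCommGroup Y] [NormedSpace ℂ Y] [CompleteSpace Y]
    (hX : 1 < Module.rank ℂ X)
    (𝒜 : NonUnitalSubalgebra ℂ (X →L[ℂ] X)) (ℬ : NonUnitalSubalgebra ℂ (Y →L[ℂ] Y))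
    (h𝒜 : ∀ T : X →L[ℂ] X, FiniteDimensional ℂ (LinearMap.range (T : X →ₗ[ℂ] X)) → T ∈ 𝒜)
    (hℬ : ∀ S : Y →L[ℂ] Y, FiniteDimensional ℂ (LinearMap.range (S : Y →ₗ[ℂ] Y)) → S ∈ ℬ)
    (φ : 𝒜 → ℬ) (hbij : Function.Bijective φ)
    (hJ : ∀ A B : 𝒜, φ (((1:ℂ)/2) • (A * B + B * A))
        = ((1:ℂ)/2) • (φ A * φ B + φ B * φ A)) :
    ∀ P Q : 𝒜, P * P = P → Q * Q = Q → P * Q = P → Q * P = P →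
      (φ P * φ Q = φ P ∧ φ Q * φ P = φ P) := by
  intro P Q hP hQ hPQ hQP
  -- `φ Q` is idempotent
  have hq : φ Q * φ Q = φ Q := by
    have h := hJ Q Q
    rw [hQ, jordan_half_smul_add_self, jordan_half_smul_add_self] at h
    exact h.symm
  -- the Jordan product of `φ P` and `φ Q` is `φ P`
  have hj : φ P = ((1:ℂ)/2) • (φ P * φ Q + φ Q * φ P) := by
    have h := hJ P Q
    rwa [hPQ, hQP, jordan_half_smul_add_self] at h
  have hs : φ P * φ Q + φ Q * φ P = φ P + φ P := by
    have h : φ P + φ P = ((1:ℂ)/2) • (φ P * φ Q + φ Q * φ P)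
        + ((1:ℂ)/2) • (φ P * φ Q + φ Q * φ P) := by rw [← hj]
    rw [h, ← smul_add, jordan_half_smul_add_self]
  generalize φ P = p at *
  generalize φ Q = q at *
  have h1 : q * p * q = q * p := by
    have h := congrArg (fun x => q * x) hs
    simp only [mul_add, ← mul_assoc, hq] at h
    exact add_right_cancel h
  have h2 : q * p * q = p * q := by
    have h := congrArg (fun x => x * q) hs
    simp only [add_mul] at h
    rw [mul_assoc p q q, hq] at h
    exact add_left_cancel h
  have h3 : p * q = q * p := h2.symm.trans h1
  have h4 : p * q = p := by
    rw [← h3] at hj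
    rw [jordan_half_smul_add_self] at hj
    exact hj.symm
  exact ⟨h4, h3 ▸ h4⟩
end

section
/- Let X be a complex Banach space, let 𝒜 ⊆ B(X) be a standard operator algebra, let P ∈ 𝒜 be an idempotent and let n be a positive integer. Then P has rank n (i.e. the range of P is n-dimensional) if and only if there is a system P₁, …, Pₙ ∈ 𝒜 of pairwise orthogonal nonzero idempotents with Pₖ ≤ P for k = 1, …, n, but there is no such system of n+1 members. -/
theorem aux_dual {X : Type*} [NormedAddCommGroup X] [NormedSpace ℂ X] {m : ℕ}
    (v : Fin m → X) (hv : LinearIndependent ℂ v) :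
    ∃ f : Fin m → (X →L[ℂ] ℂ), ∀ i j, f i (v j) = if i = j then 1 else 0 := by
  classical
  let b := Module.Basis.span hv
  haveI : FiniteDimensional ℂ (Submodule.span ℂ (Set.range v)) :=
    FiniteDimensional.span_of_finite ℂ (Set.finite_range v)
  have h : ∀ i, ∃ g : X →L[ℂ] ℂ, ∀ j, g (v j) = if i = j then 1 else 0 := by
    intro i
    obtain ⟨g, hg, -⟩ := exists_extension_norm_eq (Submodule.span ℂ (Set.range v))
      (LinearMap.toContinuousLinearMap (b.coord i))
    refine ⟨g, fun j => ?_⟩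
    have h1 : ((b j : Submodule.span ℂ (Set.range v)) : X) = v j :=
      congrArg Subtype.val (Module.Basis.span_apply hv j)
    rw [← h1, hg]
    simp [Finsupp.single_apply, eq_comm]
  choose f hf using h
  exact ⟨f, hf⟩

theorem aux_system
    {X : Type*} [NormedAddCommGroup X] [NormedSpace ℂ X]
    (𝒜 : NonUnitalSubalgebra ℂ (X →L[ℂ] X))
    (h𝒜 : ∀ T : X →L[ℂ] X, FiniteDimensional ℂ (LinearMap.range (T : X →ₗ[ℂ] X)) → T ∈ 𝒜)
    (P : 𝒜) (hP : P * P = P) (m : ℕ) :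
    (∃ Q : Fin m → 𝒜, (∀ k, Q k ≠ 0) ∧ (∀ k, Q k * Q k = Q k) ∧
          (∀ k l, k ≠ l → Q k * Q l = 0) ∧ (∀ k, Q k * P = Q k ∧ P * Q k = Q k)) ↔
    ∃ v : Fin m → LinearMap.range ((P : X →L[ℂ] X) : X →ₗ[ℂ] X), LinearIndependent ℂ v := by
  have hPx : ∀ x, (P : X →L[ℂ] X) ((P : X →L[ℂ] X) x) = (P : X →L[ℂ] X) x := fun x =>
    congrArg (fun T : 𝒜 => (T : X →L[ℂ] X) x) hP
  constructor
  · rintro ⟨Q, h0, hQ, hort, hle⟩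
    have hx : ∀ k, ∃ x, (Q k : X →L[ℂ] X) x ≠ 0 := by
      intro k
      by_contra! h
      exact h0 k (Subtype.ext (ContinuousLinearMap.ext h))
    choose x hx using hx
    have hPQ : ∀ k y, (P : X →L[ℂ] X) ((Q k : X →L[ℂ] X) y) = (Q k : X →L[ℂ] X) y :=
      fun k y => congrArg (fun T : 𝒜 => (T : X →L[ℂ] X) y) (hle k).2
    have hQQ : ∀ k y, (Q k : X →L[ℂ] X) ((Q k : X →L[ℂ] X) y) = (Q k : X →L[ℂ] X) y :=
      fun k y => congrArg (fun T : 𝒜 => (T : X →L[ℂ] X) y) (hQ k)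
    have hQl : ∀ k l, k ≠ l → ∀ y, (Q k : X →L[ℂ] X) ((Q l : X →L[ℂ] X) y) = 0 :=
      fun k l h y => congrArg (fun T : 𝒜 => (T : X →L[ℂ] X) y) (hort k l h)
    refine ⟨fun k => ⟨(Q k : X →L[ℂ] X) (x k), ⟨_, hPQ k (x k)⟩⟩, ?_⟩
    apply LinearIndependent.of_comp (Submodule.subtype _)
    rw [Fintype.linearIndependent_iff]
    intro g hg i
    have h2 := congrArg (Q i : X →L[ℂ] X) hg
    rw [map_sum, Finset.sum_eq_single i] at h2
    · simp only [Function.comp, Submodule.subtype_apply, map_smul, hQQ, map_zero,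
        smul_eq_zero] at h2
      exact h2.resolve_right (hx i)
    · intro j _ hj
      simp [hQl i j hj.symm]
    · simp
  · rintro ⟨v, hv⟩
    have hv' : LinearIndependent ℂ (fun k => (v k : X)) :=
      hv.map' (Submodule.subtype _) (Submodule.ker_subtype _)
    obtain ⟨f, hf⟩ := aux_dual _ hv'
    have hPv : ∀ k, (P : X →L[ℂ] X) (v k) = v k := by
      intro k
      obtain ⟨y, hy⟩ := (v k).2
      rw [← hy]
      exact hPx y
    let T : Fin m → (X →L[ℂ] X) := fun k =>
      ((f k).comp (P : X →L[ℂ] X)).smulRight (v k : X)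
    have hT : ∀ k y, T k y = f k ((P : X →L[ℂ] X) y) • (v k : X) := fun k y => rfl
    have hmem : ∀ k, T k ∈ 𝒜 := by
      intro k
      apply h𝒜
      apply Submodule.finiteDimensional_of_le (S₂ := Submodule.span ℂ {(v k : X)})
      rintro _ ⟨y, rfl⟩
      exact Submodule.mem_span_singleton.2 ⟨_, (hT k y).symm⟩
    refine ⟨fun k => ⟨T k, hmem k⟩, ?_, ?_, ?_, ?_⟩
    · intro k h
      have h1 : T k (v k) = 0 := congrArg (fun S : 𝒜 => (S : X →L[ℂ] X) (v k)) h
      rw [hT, hPv, hf, if_pos rfl, one_smul] at h1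
      exact hv'.ne_zero k h1
    · intro k
      apply Subtype.ext
      ext y
      change T k (T k y) = T k y
      simp [hT, hPv, hf]
    · intro k l hkl
      apply Subtype.ext
      ext y
      change T k (T l y) = 0
      simp [hT, hPv, hf, hkl]
    · intro k
      constructor
      · apply Subtype.ext
        ext y
        change T k ((P : X →L[ℂ] X) y) = T k y
        simp [hT, hPx]
      · apply Subtype.ext
        ext y
        change (P : X →L[ℂ] X) (T k y) = T k y
        simp [hT, hPv]

theorem aux_rank {V : Type*} [AddCommGroup V] [Module ℂ V] (m : ℕ) :
    (∃ v : Fin m → V, LinearIndependent ℂ v) ↔ (m : Cardinal) ≤ Module.rank ℂ V := by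
  constructor
  · rintro ⟨v, hv⟩
    simpa using hv.cardinal_lift_le_rank
  · intro h
    obtain ⟨s, hs, hl⟩ := le_rank_iff_exists_linearIndependent_finset.1 h
    exact ⟨_, hl.comp (s.equivFinOfCardEq hs).symm (Equiv.injective _)⟩

/-- An idempotent `P` in a standard operator algebra has rank `n` iff there is a system
of `n` pairwise orthogonal nonzero idempotents dominated by `P`, but no such system of
`n+1` members. -/
theorem idempotent_rank_iff_orthogonal_system
    {X : Type*} [NormedAddCommGroup X] [NormedSpace ℂ X] [CompleteSpace X]
    (𝒜 : NonUnitalSubalgebra ℂ (X →L[ℂ] X))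
    (h𝒜 : ∀ T : X →L[ℂ] X, FiniteDimensional ℂ (LinearMap.range (T : X →ₗ[ℂ] X)) → T ∈ 𝒜)
    (P : 𝒜) (hP : P * P = P) (n : ℕ) (hn : 0 < n) :
    Module.finrank ℂ (LinearMap.range ((P : X →L[ℂ] X) : X →ₗ[ℂ] X)) = n ↔
      ((∃ Q : Fin n → 𝒜, (∀ k, Q k ≠ 0) ∧ (∀ k, Q k * Q k = Q k) ∧
          (∀ k l, k ≠ l → Q k * Q l = 0) ∧ (∀ k, Q k * P = Q k ∧ P * Q k = Q k)) ∧
        ¬ (∃ Q : Fin (n + 1) → 𝒜, (∀ k, Q k ≠ 0) ∧ (∀ k, Q k * Q k = Q k) ∧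
          (∀ k l, k ≠ l → Q k * Q l = 0) ∧ (∀ k, Q k * P = Q k ∧ P * Q k = Q k))) := by
  rw [aux_system 𝒜 h𝒜 P hP, aux_system 𝒜 h𝒜 P hP, aux_rank, aux_rank]
  constructor
  · intro h
    haveI := Module.finite_of_finrank_pos (h.symm ▸ hn)
    rw [← Module.finrank_eq_rank, h]
    exact ⟨le_rfl, by norm_cast; omega⟩
  · rintro ⟨h1, h2⟩
    apply Module.finrank_eq_of_rank_eq
    refine le_antisymm ?_ h1
    rw [← Order.lt_succ_iff, ← Cardinal.nat_succ]
    exact not_le.1 h2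
end

section
/- Let X and Y be complex Banach spaces with dim X > 1, let 𝒜 ⊆ B(X) and ℬ ⊆ B(Y) be standard operator algebras, and let φ : 𝒜 → ℬ be a bijective transformation satisfying φ((1/2)(AB+BA)) = (1/2)(φ(A)φ(B)+φ(B)φ(A)) for all A, B ∈ 𝒜. Then φ is orthoadditive on finite rank idempotents: for all orthogonal finite rank idempotents P, Q ∈ 𝒜, φ(P+Q) = φ(P) + φ(Q). -/
/-- Abstract version: any bijective Jordan-multiplicative map is orthoadditive. -/
theorem jordan_aux {A B : Type*} [NonUnitalRing A] [Module ℂ A] [NonUnitalRing B] [Module ℂ B]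
    (φ : A → B) (hbij : Function.Bijective φ)
    (hJ : ∀ a b : A, φ (((1:ℂ)/2) • (a * b + b * a))
        = ((1:ℂ)/2) • (φ a * φ b + φ b * φ a))
    (P Q : A) (hP : P * P = P) (hQ : Q * Q = Q) (hPQ : P * Q = 0) (hQP : Q * P = 0) :
    φ (P + Q) = φ P + φ Q := by
  have half : ∀ a : A, ((1:ℂ)/2) • (a + a) = a := by
    intro a
    rw [← two_smul ℂ a, smul_smul]
    norm_num
  have halfB : ∀ a : B, ((1:ℂ)/2) • (a + a) = a := by
    intro a
    rw [← two_smul ℂ a, smul_smul]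
    norm_num
  have h0 : φ 0 = 0 := by
    obtain ⟨A, hA⟩ := hbij.2 0
    have h := hJ A 0
    simpa [hA] using h
  have hPP : φ P * φ P = φ P := by
    have h := hJ P P
    rw [hP, half, halfB] at h
    exact h.symm
  have hQQ : φ Q * φ Q = φ Q := by
    have h := hJ Q Q
    rw [hQ, half, halfB] at h
    exact h.symm
  have hort : ((1:ℂ)/2) • (φ P * φ Q + φ Q * φ P) = 0 := by
    rw [← hJ, hPQ, hQP]
    simpa using h0
  have hort' : φ P * φ Q + φ Q * φ P = 0 :=
    (smul_eq_zero.mp hort).resolve_left (by norm_num)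
  obtain ⟨R, hR⟩ := hbij.2 (φ P + φ Q)
  have hRP : ((1:ℂ)/2) • (R * P + P * R) = P := by
    apply hbij.1
    rw [hJ, hR]
    have e : (φ P + φ Q) * φ P + φ P * (φ P + φ Q)
        = (φ P * φ P + φ P * φ P) + (φ P * φ Q + φ Q * φ P) := by
      rw [add_mul, mul_add]; abel
    rw [e, hort', hPP, add_zero, halfB]
  have hRQ : ((1:ℂ)/2) • (R * Q + Q * R) = Q := by
    apply hbij.1
    rw [hJ, hR]
    have e : (φ P + φ Q) * φ Q + φ Q * (φ P + φ Q)
        = (φ Q * φ Q + φ Q * φ Q) + (φ P * φ Q + φ Q * φ P) := by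
      rw [add_mul, mul_add]; abel
    rw [e, hort', hQQ, add_zero, halfB]
  have hRT : ((1:ℂ)/2) • (R * (P + Q) + (P + Q) * R) = P + Q := by
    have e : R * (P + Q) + (P + Q) * R = (R * P + P * R) + (R * Q + Q * R) := by
      rw [add_mul, mul_add]; abel
    rw [e, smul_add, hRP, hRQ]
  have hTP : ((1:ℂ)/2) • (φ (P + Q) * φ P + φ P * φ (P + Q)) = φ P := by
    rw [← hJ, add_mul, mul_add, hP, hPQ, hQP, add_zero, half]
  have hTQ : ((1:ℂ)/2) • (φ (P + Q) * φ Q + φ Q * φ (P + Q)) = φ Q := by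
    rw [← hJ, add_mul, mul_add, hQ, hPQ, hQP, zero_add, half]
  have e : (φ P + φ Q) * φ (P + Q) + φ (P + Q) * (φ P + φ Q)
      = (φ (P + Q) * φ P + φ P * φ (P + Q)) + (φ (P + Q) * φ Q + φ Q * φ (P + Q)) := by
    rw [add_mul, mul_add]; abel
  have h := hJ R (P + Q)
  rw [hRT, hR, e, smul_add, hTP, hTQ] at h
  exact h

theorem jordan_map_orthoadditive_on_finite_rank_idempotents
    {X Y : Type*} [NormedAddCommGroup X] [NormedSpace ℂ X] [CompleteSpace X]
    [NormedAddCommGroup Y] [NormedSpace ℂ Y] [CompleteSpace Y]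
    (hX : 1 < Module.rank ℂ X)
    (𝒜 : NonUnitalSubalgebra ℂ (X →L[ℂ] X)) (ℬ : NonUnitalSubalgebra ℂ (Y →L[ℂ] Y))
    (h𝒜 : ∀ T : X →L[ℂ] X, FiniteDimensional ℂ (LinearMap.range (T : X →ₗ[ℂ] X)) → T ∈ 𝒜)
    (hℬ : ∀ S : Y →L[ℂ] Y, FiniteDimensional ℂ (LinearMap.range (S : Y →ₗ[ℂ] Y)) → S ∈ ℬ)
    (φ : 𝒜 → ℬ) (hbij : Function.Bijective φ)
    (hJ : ∀ A B : 𝒜, φ (((1:ℂ)/2) • (A * B + B * A))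
        = ((1:ℂ)/2) • (φ A * φ B + φ B * φ A)) :
    ∀ P Q : 𝒜, P * P = P → Q * Q = Q →
      FiniteDimensional ℂ (LinearMap.range ((P : X →L[ℂ] X) : X →ₗ[ℂ] X)) →
      FiniteDimensional ℂ (LinearMap.range ((Q : X →L[ℂ] X) : X →ₗ[ℂ] X)) →
      P * Q = 0 → Q * P = 0 →
      φ (P + Q) = φ P + φ Q := by
  intro P Q hP hQ _ _ hPQ hQP
  exact jordan_aux φ hbij hJ P Q hP hQ hPQ hQP
end

section
/- Let X and Y be complex Banach spaces with dim X > 1, let 𝒜 ⊆ B(X) and ℬ ⊆ B(Y) be standard operator algebras, and let φ : 𝒜 → ℬ be a bijective transformation satisfying φ((1/2)(AB+BA)) = (1/2)(φ(A)φ(B)+φ(B)φ(A)) for all A, B ∈ 𝒜. Then φ(-P) = -φ(P) for every finite rank idempotent P ∈ 𝒜. -/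
theorem half_smul_self {B : Type*} [AddCommGroup B] [Module ℂ B] (a : B) :
    ((1:ℂ)/2) • (a + a) = a := by
  rw [← two_smul ℂ a, smul_smul]; norm_num

theorem jordan_abstract {𝒜 ℬ : Type*} [NonUnitalRing 𝒜] [Module ℂ 𝒜]
    [NonUnitalRing ℬ] [Module ℂ ℬ]
    (φ : 𝒜 → ℬ) (hbij : Function.Bijective φ)
    (hJ : ∀ A B : 𝒜, φ (((1:ℂ)/2) • (A * B + B * A))
        = ((1:ℂ)/2) • (φ A * φ B + φ B * φ A))
    (hprime : ∀ S T : ℬ, (∀ W, S * W * T = 0) → S = 0 ∨ T = 0)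
    (P : 𝒜) (hP : P * P = P) : φ (-P) = -φ P := by
  have h0 : φ 0 = 0 := by
    obtain ⟨Z, hZ⟩ := hbij.2 0
    have := hJ 0 Z
    simpa [hZ] using this
  have hQQ : φ P * φ P = φ P := by
    have := hJ P P
    rw [half_smul_self, half_smul_self, hP] at this
    exact this.symm
  have hRR : φ (-P) * φ (-P) = φ P := by
    have := hJ (-P) (-P)
    rw [half_smul_self, half_smul_self, neg_mul_neg, hP] at this
    exact this.symm
  have hcomm : φ P * φ (-P) = φ (-P) * φ P := by
    rw [← hRR, mul_assoc]
  have hRQ : φ (-P) * φ P = φ (-P) := by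
    have := hJ (-P) P
    rw [hcomm, half_smul_self, neg_mul, mul_neg, hP, half_smul_self] at this
    exact this.symm
  have hQR : φ P * φ (-P) = φ (-P) := hcomm.trans hRQ
  -- key associativity
  have key : ∀ S T : ℬ, φ P * S = S → S * φ P = S → φ P * T = T → T * φ P = T →
      ((1:ℂ)/2) • ((((1:ℂ)/2) • (φ (-P) * S + S * φ (-P))) * T
        + T * (((1:ℂ)/2) • (φ (-P) * S + S * φ (-P))))
      = ((1:ℂ)/2) • ((((1:ℂ)/2) • (φ (-P) * T + T * φ (-P))) * S
        + S * (((1:ℂ)/2) • (φ (-P) * T + T * φ (-P)))) := by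
    intro S T h1 h2 h3 h4
    obtain ⟨A, rfl⟩ := hbij.2 S
    obtain ⟨C, rfl⟩ := hbij.2 T
    have n : ∀ A : 𝒜, φ P * φ A = φ A → φ A * φ P = φ A →
        ((1:ℂ)/2) • (φ (-P) * φ A + φ A * φ (-P)) = φ (-A) := by
      intro A h1 h2
      have e : ((1:ℂ)/2) • (P * A + A * P) = A := by
        apply hbij.1
        rw [hJ, h1, h2, half_smul_self]
      rw [← hJ, neg_mul, mul_neg, ← neg_add, smul_neg, e]
    rw [n A h1 h2, n C h3 h4, ← hJ, ← hJ]
    congr 2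
    rw [neg_mul, mul_neg, neg_mul, mul_neg, add_comm]
  generalize hR : φ (-P) = R at *
  generalize hQ : φ P = Q at *
  have hz : ∀ W : ℬ, (Q + R) * W * (Q - R) = 0 := by
    intro W
    have a1 : Q * (Q + R) = Q + R := by rw [mul_add, hQQ, hQR]
    have a2 : (Q + R) * Q = Q + R := by rw [add_mul, hQQ, hRQ]
    have a3 : R * (Q + R) = Q + R := by rw [mul_add, hRR, hRQ, add_comm]
    have a4 : (Q + R) * R = Q + R := by rw [add_mul, hRR, hQR, add_comm]
    have b1 : (Q - R) * Q = Q - R := by rw [sub_mul, hQQ, hRQ]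
    have b2 : (Q - R) * R = -(Q - R) := by rw [sub_mul, hRR, hQR, neg_sub]
    have t1 : Q * ((Q + R) * W * (Q - R)) = (Q + R) * W * (Q - R) := by
      rw [← mul_assoc, ← mul_assoc, a1]
    have t2 : (Q + R) * W * (Q - R) * Q = (Q + R) * W * (Q - R) := by
      rw [mul_assoc, b1]
    have t3 : R * ((Q + R) * W * (Q - R)) = (Q + R) * W * (Q - R) := by
      rw [← mul_assoc, ← mul_assoc, a3]
    have t4 : (Q + R) * W * (Q - R) * R = -((Q + R) * W * (Q - R)) := by
      rw [mul_assoc, b2, mul_neg]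
    have k := key (Q + R) ((Q + R) * W * (Q - R)) a1 a2 t1 t2
    rw [a3, a4, half_smul_self, t3, t4, add_neg_cancel, smul_zero, zero_mul, mul_zero, add_zero,
      smul_zero, add_mul Q R, mul_add _ Q R, t1, t2, t3, t4, add_neg_cancel, add_zero,
      half_smul_self] at k
    exact k
  have hor := hprime _ _ hz
  rcases hor with h | h
  · exact eq_neg_of_add_eq_zero_right h
  · have hPP : P = -P := hbij.1 (by rw [hQ, hR]; exact sub_eq_zero.1 h)
    have hP0 : P = 0 := by
      have := half_smul_self P
      nth_rewrite 2 [hPP] at this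
      rw [add_neg_cancel, smul_zero] at this
      exact this.symm
    subst hP0
    rw [← hR, ← hQ, neg_zero, h0, neg_zero]

theorem jordan_map_neg_of_finite_rank_idempotent
    {X Y : Type*} [NormedAddCommGroup X] [NormedSpace ℂ X] [CompleteSpace X]
    [NormedAddCommGroup Y] [NormedSpace ℂ Y] [CompleteSpace Y]
    (hX : 1 < Module.rank ℂ X)
    (𝒜 : NonUnitalSubalgebra ℂ (X →L[ℂ] X)) (ℬ : NonUnitalSubalgebra ℂ (Y →L[ℂ] Y))
    (h𝒜 : ∀ T : X →L[ℂ] X, FiniteDimensional ℂ (LinearMap.range (T : X →ₗ[ℂ] X)) → T ∈ 𝒜)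
    (hℬ : ∀ S : Y →L[ℂ] Y, FiniteDimensional ℂ (LinearMap.range (S : Y →ₗ[ℂ] Y)) → S ∈ ℬ)
    (φ : 𝒜 → ℬ) (hbij : Function.Bijective φ)
    (hJ : ∀ A B : 𝒜, φ (((1:ℂ)/2) • (A * B + B * A))
        = ((1:ℂ)/2) • (φ A * φ B + φ B * φ A)) :
    ∀ P : 𝒜, P * P = P →
      FiniteDimensional ℂ (LinearMap.range ((P : X →L[ℂ] X) : X →ₗ[ℂ] X)) →
      φ (-P) = -φ P := by
  intro P hP _
  refine jordan_abstract φ hbij hJ ?_ P hP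
  · intro S T hz
    by_contra hcon
    push Not at hcon
    obtain ⟨h1, h2⟩ := hcon
    have h1' : (S : Y →L[ℂ] Y) ≠ 0 := fun h => h1 (Subtype.ext h)
    have h2' : (T : Y →L[ℂ] Y) ≠ 0 := fun h => h2 (Subtype.ext h)
    obtain ⟨y, hy⟩ := DFunLike.ne_iff.1 h1'
    obtain ⟨z, hz'⟩ := DFunLike.ne_iff.1 h2'
    obtain ⟨f, hf⟩ := SeparatingDual.exists_ne_zero (R := ℂ) hz'
    have hfin : FiniteDimensional ℂ
        (LinearMap.range ((f.smulRight y : Y →L[ℂ] Y) : Y →ₗ[ℂ] Y)) := by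
      have hle : LinearMap.range ((f.smulRight y : Y →L[ℂ] Y) : Y →ₗ[ℂ] Y)
          ≤ Submodule.span ℂ {y} := by
        rintro _ ⟨x, rfl⟩
        exact Submodule.mem_span_singleton.2 ⟨f x, rfl⟩
      exact Submodule.finiteDimensional_of_le hle
    have e := congrArg (fun V : ℬ => (V : Y →L[ℂ] Y) z) (hz ⟨_, hℬ _ hfin⟩)
    have e' : f ((T : Y →L[ℂ] Y) z) • (S : Y →L[ℂ] Y) y = 0 := by
      rw [← map_smul]; exact e
    rcases smul_eq_zero.1 e' with h | h
    · exact hf h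
    · exact hy h
end

section
/- Let X and Y be complex Banach spaces with dim X > 1, let 𝒜 ⊆ B(X) and ℬ ⊆ B(Y) be standard operator algebras, and let φ : 𝒜 → ℬ be a bijective transformation satisfying φ((1/2)(AB+BA)) = (1/2)(φ(A)φ(B)+φ(B)φ(A)) for all A, B ∈ 𝒜. Then for every finite rank operator T ∈ F(X) and every finite rank idempotent P ∈ F(X) one has φ(PTP) = φ(P)φ(T)φ(P). -/
set_option linter.unusedSectionVars false
set_option linter.unusedSimpArgs false

namespace JMap

section abs
variable {R S : Type*} [NonUnitalRing R] [Module ℂ R] [IsScalarTower ℂ R R] [SMulCommClass ℂ R R]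
  [NonUnitalRing S] [Module ℂ S] [IsScalarTower ℂ S S] [SMulCommClass ℂ S S]

/-- Jordan product -/
noncomputable def jo (a b : R) : R := ((1:ℂ)/2) • (a * b + b * a)

lemma jo_comm (a b : R) : jo a b = jo b a := by simp only [jo, add_comm]
lemma add_jo (a b c : R) : jo (a + b) c = jo a c + jo b c := by
  simp only [jo, add_mul, mul_add]; module
lemma jo_add (a b c : R) : jo c (a + b) = jo c a + jo c b := by
  simp only [jo, add_mul, mul_add]; module
lemma sub_jo (a b c : R) : jo (a - b) c = jo a c - jo b c := by
  simp only [jo, sub_mul, mul_sub]; module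
@[simp] lemma zero_jo (c : R) : jo 0 c = 0 := by simp [jo]
@[simp] lemma jo_zero (c : R) : jo c 0 = 0 := by simp [jo]

/-- Peirce spaces -/
def J1 (p a : R) : Prop := p * a = a ∧ a * p = a
def J0 (p a : R) : Prop := p * a = 0 ∧ a * p = 0
def Jh (p a : R) : Prop := p * a + a * p = a

lemma J1.sub {p a b : R} (ha : J1 p a) (hb : J1 p b) : J1 p (a - b) := by
  simp only [J1, mul_sub, sub_mul, ha.1, ha.2, hb.1, hb.2, and_self]
lemma J1.add {p a b : R} (ha : J1 p a) (hb : J1 p b) : J1 p (a + b) := by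
  simp only [J1, mul_add, add_mul, ha.1, ha.2, hb.1, hb.2, and_self]
lemma J0.sub {p a b : R} (ha : J0 p a) (hb : J0 p b) : J0 p (a - b) := by
  simp only [J0, mul_sub, sub_mul, ha.1, ha.2, hb.1, hb.2, and_self, sub_zero]
lemma J0.add {p a b : R} (ha : J0 p a) (hb : J0 p b) : J0 p (a + b) := by
  simp only [J0, mul_add, add_mul, ha.1, ha.2, hb.1, hb.2, and_self, add_zero]
lemma Jh.add {p a b : R} (ha : Jh p a) (hb : Jh p b) : Jh p (a + b) := by
  unfold Jh at *
  conv_rhs => rw [← ha, ← hb]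
  simp only [mul_add, add_mul]; abel
lemma Jh.sub {p a b : R} (ha : Jh p a) (hb : Jh p b) : Jh p (a - b) := by
  unfold Jh at *
  conv_rhs => rw [← ha, ← hb]
  simp only [mul_sub, sub_mul]; abel
lemma Jh.smul {p a : R} (c : ℂ) (ha : Jh p a) : Jh p (c • a) := by
  unfold Jh at *
  conv_rhs => rw [← ha]
  simp only [mul_smul_comm, smul_mul_assoc, smul_add]
lemma Jh.zero (p : R) : Jh p 0 := by simp [Jh]

lemma Jh.left {p a : R} (ha : Jh p a) : p * a = a - a * p := eq_sub_of_add_eq ha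

lemma J1.jo_J0 {p a b : R} (ha : J1 p a) (hb : J0 p b) : jo a b = 0 := by
  have h1 : a * b = 0 := by rw [← ha.2, mul_assoc, hb.1, mul_zero]
  have h2 : b * a = 0 := by rw [← ha.1, ← mul_assoc, hb.2, zero_mul]
  simp [jo, h1, h2]
lemma J0.jo_J1 {p a b : R} (ha : J0 p a) (hb : J1 p b) : jo a b = 0 := by
  rw [jo_comm, hb.jo_J0 ha]
lemma J0.jo_J0 {p a b : R} (ha : J0 p a) (hb : J0 p b) : J0 p (jo a b) := by
  constructor
  · simp only [jo, mul_smul_comm, mul_add, ← mul_assoc, ha.1, hb.1]; simp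
  · simp only [jo, smul_mul_assoc, add_mul, mul_assoc, ha.2, hb.2]; simp
lemma J1.jo_p {p a : R} (ha : J1 p a) : jo a p = a := by
  simp only [jo, ha.1, ha.2]; module
lemma J0.jo_p {p a : R} (ha : J0 p a) : jo a p = 0 := by
  simp only [jo, ha.1, ha.2]; simp
lemma Jh.jo_p {p a : R} (ha : Jh p a) : jo a p = ((1:ℂ)/2) • a := by
  simp only [jo]; rw [add_comm, ha]
lemma Jh.jo_J0 {p a u : R} (ha : Jh p a) (hu : J0 p u) : Jh p (jo a u) := by
  have h1 : p * (a * u) = a * u := by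
    rw [← mul_assoc, ha.left, sub_mul, mul_assoc, hu.1, mul_zero, sub_zero]
  have h2 : u * a * p = u * a := by
    have : a * p = a - p * a := eq_sub_of_add_eq' ha
    rw [mul_assoc, this, mul_sub, ← mul_assoc, hu.2, zero_mul, sub_zero]
  have h3 : p * (u * a) = 0 := by rw [← mul_assoc, hu.1, zero_mul]
  have h4 : a * u * p = 0 := by rw [mul_assoc, hu.2, mul_zero]
  simp only [Jh, jo, mul_smul_comm, smul_mul_assoc, mul_add, add_mul, h1, h2, h3, h4]
  module
lemma Jh.jo_J1 {p a c : R} (ha : Jh p a) (hc : J1 p c) : Jh p (jo a c) := by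
  have h1 : p * (a * c) = 0 := by
    rw [← mul_assoc, ha.left, sub_mul, mul_assoc, hc.1, sub_self]
  have h2 : c * a * p = 0 := by
    have : a * p = a - p * a := eq_sub_of_add_eq' ha
    rw [mul_assoc, this, mul_sub, ← mul_assoc, hc.2, sub_self]
  have h3 : p * (c * a) = c * a := by rw [← mul_assoc, hc.1]
  have h4 : a * c * p = a * c := by rw [mul_assoc, hc.2]
  simp only [Jh, jo, mul_smul_comm, smul_mul_assoc, mul_add, add_mul, h1, h2, h3, h4]
  module

lemma Jh.comm {p a b : R} (ha : Jh p a) (hb : Jh p b) : p * (a * b) = a * b * p := by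
  rw [← mul_assoc, ha.left, sub_mul, mul_assoc, hb.left, mul_sub, mul_assoc]; abel

lemma Jh.jo_Jh {p a b : R} (hp : p * p = p) (ha : Jh p a) (hb : Jh p b) :
    ∃ c d, J1 p c ∧ J0 p d ∧ jo a b = c + d := by
  have hm : p * jo a b = jo a b * p := by
    simp only [jo, mul_smul_comm, smul_mul_assoc, mul_add, add_mul, ha.comm hb, hb.comm ha]
  generalize jo a b = m at *
  have h1 : p * (p * m) = p * m := by rw [← mul_assoc, hp]
  have h2 : p * m * p = p * m := by rw [mul_assoc, ← hm, h1]
  refine ⟨p * m, m - p * m, ⟨h1, h2⟩, ⟨?_, ?_⟩, by abel⟩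
  · rw [mul_sub, h1, sub_self]
  · rw [sub_mul, h2, hm, sub_self]

lemma decomp {p : R} (hp : p * p = p) (a : R) :
    ∃ a1 ah a0, J1 p a1 ∧ Jh p ah ∧ J0 p a0 ∧ a = a1 + ah + a0 := by
  have h1 (x : R) : p * (p * x) = p * x := by rw [← mul_assoc, hp]
  refine ⟨p * a * p, p * a + a * p - p * a * p - p * a * p, a - p * a - a * p + p * a * p,
    ⟨?_, ?_⟩, ?_, ⟨?_, ?_⟩, by abel⟩
  all_goals
    simp only [Jh, mul_sub, sub_mul, mul_add, add_mul, mul_assoc, hp, h1]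
    try abel

lemma uniq {p a b c : R} (ha : J1 p a) (hb : Jh p b) (hc : J0 p c) (h : a + b + c = 0) :
    a = 0 ∧ b = 0 ∧ c = 0 := by
  have e1 : p * (a + b + c) + (a + b + c) * p = 0 := by rw [h]; simp
  have e2 : a + a + b = 0 := by
    rw [← e1]; simp only [mul_add, add_mul, ha.1, ha.2, hc.1, hc.2]
    nth_rewrite 1 [← hb]; abel
  have e3 : p * (a + a + b) + (a + a + b) * p = 0 := by rw [e2]; simp
  have e4 : a + a + a + a + b = 0 := by
    rw [← e3]; simp only [mul_add, add_mul, ha.1, ha.2]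
    nth_rewrite 1 [← hb]; abel
  have e5 : (2:ℂ) • a = 0 := by
    have : a + a = (a + a + a + a + b) - (a + a + b) := by abel
    rw [two_smul, this, e4, e2, sub_zero]
  have ea : a = 0 := by simpa using e5
  subst ea
  have eb : b = 0 := by simpa using e2
  subst eb
  simpa using h

theorem additive {φ : R → S} (hb : Function.Bijective φ)
    (hJ : ∀ a b, φ (jo a b) = jo (φ a) (φ b)) {p : R} (hp : p * p = p)
    (F1 : ∀ c, J1 p c → (∀ t, Jh p t → jo c t = 0) → c = 0)
    (F0 : ∀ c, J0 p c → (∀ t, Jh p t → jo c t = 0) → c = 0)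
    (Fh : ∀ c, Jh p c → (∀ t, J0 p t → jo c t = 0) → c = 0)
    (F00 : ∀ c, J0 p c → (∀ t, J0 p t → jo c t = 0) → c = 0)
    (Fs : ∀ a, Jh p a → ∃ b c u v, Jh p b ∧ Jh p c ∧ J0 p u ∧ J0 p v ∧ a = b + c ∧
      jo b u = ((1:ℂ)/2) • b ∧ jo c v = ((1:ℂ)/2) • c) (a b : R) :
    φ (a + b) = φ a + φ b := by
  have inj := hb.1
  have hp1 : J1 p p := ⟨hp, hp⟩
  have φ0 : φ 0 = 0 := by
    obtain ⟨z, hz⟩ := hb.2 0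
    have := hJ 0 z
    simpa [hz] using this
  have K : ∀ {s x y}, φ s = φ x + φ y → ∀ t, φ (jo s t) = φ (jo x t) + φ (jo y t) := by
    intro s x y h t
    rw [hJ, h, add_jo, ← hJ, ← hJ]
  have K3 : ∀ {s x y z}, φ s = φ x + φ y + φ z → ∀ t,
      φ (jo s t) = φ (jo x t) + φ (jo y t) + φ (jo z t) := by
    intro s x y z h t
    rw [hJ, h, add_jo, add_jo, ← hJ, ← hJ, ← hJ]
  have half : ∀ {x y : R}, ((1:ℂ)/2) • x = ((1:ℂ)/2) • y → x = y := by
    intro x y h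
    exact smul_right_injective R (by norm_num : ((1:ℂ)/2) ≠ 0) h
  have hz0 : J0 p 0 := by simp [J0]
  -- step 1a
  have S1 : ∀ a1 ah, J1 p a1 → Jh p ah → φ (a1 + ah) = φ a1 + φ ah := by
    intro a1 ah h1 hh
    obtain ⟨s, hs⟩ := hb.2 (φ a1 + φ ah)
    obtain ⟨s1, sh, s0, g1, gh, g0, e⟩ := decomp hp s
    have key : ∀ t, J0 p t → jo (sh - ah) t = 0 ∧ jo s0 t = 0 := by
      intro t ht
      have := K hs t
      rw [h1.jo_J0 ht, φ0, zero_add] at this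
      have := inj this
      rw [e, add_jo, add_jo, g1.jo_J0 ht, zero_add] at this
      have h3 : (0:R) + jo (sh - ah) t + jo s0 t = 0 := by
        rw [sub_jo, ← this]; abel
      exact (uniq ⟨by simp, by simp⟩ ((gh.sub hh).jo_J0 ht) (g0.jo_J0 ht) h3).2
    have eh : sh = ah := sub_eq_zero.1 (Fh _ (gh.sub hh) fun t ht => (key t ht).1)
    have e0 : s0 = 0 := F00 _ g0 fun t ht => (key t ht).2
    subst eh; subst e0
    rw [add_zero] at e
    have e1 : s1 = a1 := by
      refine sub_eq_zero.1 (F1 _ (g1.sub h1) fun t ht => ?_)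
      have hht : Jh p (jo (s1 - a1) t) := by rw [jo_comm]; exact ht.jo_J1 (g1.sub h1)
      refine Fh _ hht fun u hu => ?_
      have := K (K (K hs t) u) p
      have hv : jo (jo (jo sh t) u) p = 0 := by
        obtain ⟨c, d, hc, hd, hcd⟩ := hh.jo_Jh hp ht
        rw [hcd, add_jo, hc.jo_J0 hu, zero_add, (hd.jo_J0 hu).jo_p]
      rw [hv, φ0, add_zero] at this
      have := inj this
      rw [e, add_jo, add_jo, add_jo, hv, add_zero] at this
      apply half
      rw [← (hht.jo_J0 hu).jo_p, sub_jo, sub_jo, sub_jo, this]; simp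
    rw [← hs, e, e1]
  -- step 1b
  have S0 : ∀ ah a0, Jh p ah → J0 p a0 → φ (ah + a0) = φ ah + φ a0 := by
    intro ah a0 hh h0
    obtain ⟨s, hs⟩ := hb.2 (φ ah + φ a0)
    obtain ⟨s1, sh, s0, g1, gh, g0, e⟩ := decomp hp s
    have key : s1 = 0 ∧ sh = ah := by
      have := K hs p
      rw [h0.jo_p, φ0, add_zero] at this
      have := inj this
      rw [e, add_jo, add_jo, g1.jo_p, gh.jo_p, hh.jo_p, g0.jo_p, add_zero] at this
      have h3 : s1 + ((1:ℂ)/2) • (sh - ah) + 0 = 0 := by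
        rw [smul_sub, add_zero, ← add_sub_assoc, this, sub_self]
      obtain ⟨q1, q2, -⟩ := uniq g1 ((gh.sub hh).smul _) hz0 h3
      exact ⟨q1, sub_eq_zero.1 (half (by rw [q2, smul_zero]))⟩
    obtain ⟨e1, eh⟩ := key
    subst eh; subst e1
    rw [zero_add] at e
    have e1 : s0 = a0 := by
      refine sub_eq_zero.1 (F0 _ (g0.sub h0) fun t ht => ?_)
      have hht : Jh p (jo (s0 - a0) t) := by rw [jo_comm]; exact ht.jo_J0 (g0.sub h0)
      refine Fh _ hht fun u hu => ?_
      have := K (K (K hs t) p) u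
      have hv : jo (jo (jo sh t) p) u = 0 := by
        obtain ⟨c, d, hc, hd, hcd⟩ := hh.jo_Jh hp ht
        rw [hcd, add_jo, hd.jo_p, add_zero, hc.jo_p, hc.jo_J0 hu]
      rw [hv, φ0, zero_add] at this
      have := inj this
      rw [e, add_jo, add_jo, add_jo, hv, zero_add] at this
      have h5 : jo (jo (jo (s0 - a0) t) p) u = 0 := by
        rw [sub_jo, sub_jo, sub_jo, this, sub_self]
      rw [hht.jo_p] at h5
      apply half
      rw [smul_zero, ← h5]; simp only [jo, smul_mul_assoc, mul_smul_comm]; module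
    rw [← hs, e, e1]
  -- three-way split
  have S3 : ∀ a1 ah a0, J1 p a1 → Jh p ah → J0 p a0 →
      φ (a1 + ah + a0) = φ a1 + φ ah + φ a0 := by
    intro a1 ah a0 h1 hh h0
    obtain ⟨s, hs⟩ := hb.2 (φ a1 + φ ah + φ a0)
    obtain ⟨s1, sh, s0, g1, gh, g0, e⟩ := decomp hp s
    have key : s1 = a1 ∧ sh = ah := by
      have := K3 hs p
      rw [h0.jo_p, φ0, add_zero, h1.jo_p, hh.jo_p, ← S1 _ _ h1 (hh.smul _)] at this
      have := inj this
      rw [e, add_jo, add_jo, g1.jo_p, gh.jo_p, g0.jo_p, add_zero] at this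
      have h3 : (s1 - a1) + ((1:ℂ)/2) • (sh - ah) + 0 = 0 := by
        have : (s1 - a1) + ((1:ℂ)/2) • (sh - ah) + 0
          = (s1 + ((1:ℂ)/2) • sh) - (a1 + ((1:ℂ)/2) • ah) := by module
        rw [this, sub_eq_zero]; assumption
      obtain ⟨q1, q2, -⟩ := uniq (g1.sub h1) ((gh.sub hh).smul _) hz0 h3
      exact ⟨sub_eq_zero.1 q1, sub_eq_zero.1 (half (by rw [q2, smul_zero]))⟩
    obtain ⟨e1, eh⟩ := key
    subst eh; subst e1
    have e0 : s0 = a0 := by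
      refine sub_eq_zero.1 (F00 _ (g0.sub h0) fun t ht => ?_)
      have := K3 hs t
      rw [h1.jo_J0 ht, φ0, zero_add, ← S0 _ _ (hh.jo_J0 ht) (h0.jo_J0 ht)] at this
      have := inj this
      rw [e, add_jo, add_jo, h1.jo_J0 ht, zero_add] at this
      rw [sub_jo, add_left_cancel this, sub_self]
    rw [← hs, e, e0]
  have S10 : ∀ a1 a0, J1 p a1 → J0 p a0 → φ (a1 + a0) = φ a1 + φ a0 := by
    intro a1 a0 h1 h0
    simpa [φ0] using S3 a1 0 a0 h1 (Jh.zero p) h0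
  -- step 2
  have H1 : ∀ x y u, Jh p x → Jh p y → J0 p u → jo y u = ((1:ℂ)/2) • y →
      φ (x + y) = φ x + φ y := by
    intro x y u hx hy hu hyu
    have hX := hx.smul 2
    have hY := hy.smul 2
    have e1 : jo (p + (2:ℂ) • y) ((2:ℂ) • x + u)
        = x + y + jo ((2:ℂ) • y) ((2:ℂ) • x) := by
      rw [add_jo, jo_add, jo_add, hp1.jo_J0 hu, jo_comm p, hX.jo_p]
      have : jo ((2:ℂ) • y) u = (2:ℂ) • jo y u := by
        simp only [jo, smul_mul_assoc, mul_smul_comm]; module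
      rw [this, hyu]; module
    obtain ⟨c, d, hc, hd, hcd⟩ := hY.jo_Jh hp hX
    have e2 : φ (jo (p + (2:ℂ) • y) ((2:ℂ) • x + u)) = φ x + φ y + (φ c + φ d) := by
      rw [hJ, S1 _ _ hp1 hY, S0 _ _ hX hu, add_jo, jo_add, jo_add, ← hJ, ← hJ, ← hJ, ← hJ,
        hp1.jo_J0 hu, φ0, add_zero, jo_comm p, hX.jo_p, hcd, S10 _ _ hc hd]
      have h1 : jo ((2:ℂ) • y) u = y := by
        have : jo ((2:ℂ) • y) u = (2:ℂ) • jo y u := by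
          simp only [jo, smul_mul_assoc, mul_smul_comm]; module
        rw [this, hyu]; module
      have h2 : ((1:ℂ)/2) • (2:ℂ) • x = x := by module
      rw [h1, h2]; abel
    have e3 : x + y + (c + d) = c + (x + y) + d := by abel
    rw [e1, hcd, e3, S3 _ _ _ hc (hx.add hy) hd] at e2
    have e4 : φ c + φ (x + y) + φ d = φ (x + y) + (φ c + φ d) := by abel
    rw [e4] at e2
    exact add_right_cancel e2
  have H : ∀ x y, Jh p x → Jh p y → φ (x + y) = φ x + φ y := by
    intro x y hx hy
    obtain ⟨b, c, u, v, hb, hc, hu, hv, e, e1, e2⟩ := Fs y hy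
    rw [e, ← add_assoc, H1 _ _ v (hx.add hb) hc hv e2, H1 _ _ u hx hb hu e1,
      H1 _ _ v hb hc hv e2, add_assoc]
  -- step 3
  have A1 : ∀ x y, J1 p x → J1 p y → φ (x + y) = φ x + φ y := by
    intro x y hx hy
    obtain ⟨s, hs⟩ := hb.2 (φ x + φ y)
    have h1 : jo s p = s := by
      apply inj; rw [K hs p, hx.jo_p, hy.jo_p, hs]
    obtain ⟨s1, sh, s0, g1, gh, g0, e⟩ := decomp hp s
    rw [e, add_jo, add_jo, g1.jo_p, gh.jo_p, g0.jo_p, add_zero] at h1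
    have h3 : (0:R) + ((1:ℂ)/2) • sh + s0 = 0 := by
      have : (0:R) + ((1:ℂ)/2) • sh + s0 = (s1 + sh + s0) - (s1 + ((1:ℂ)/2) • sh) := by module
      rw [this, h1, sub_self]
    obtain ⟨-, q1, q2⟩ := uniq ⟨by simp, by simp⟩ (gh.smul _) g0 h3
    have q1 : sh = 0 := half (by rw [q1, smul_zero])
    rw [q1, q2, add_zero, add_zero] at e
    have : s1 = x + y := by
      refine sub_eq_zero.1 (F1 _ (g1.sub (hx.add hy)) fun t ht => ?_)
      have := K hs t
      have k1 := ht.jo_J1 hx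
      have k2 := ht.jo_J1 hy
      rw [jo_comm] at k1 k2
      rw [← H _ _ k1 k2] at this
      have := inj this
      rw [sub_jo, ← e, this, add_jo, sub_self]
    rw [← hs, e, this]
  have A0 : ∀ x y, J0 p x → J0 p y → φ (x + y) = φ x + φ y := by
    intro x y hx hy
    obtain ⟨s, hs⟩ := hb.2 (φ x + φ y)
    have h1 : jo s p = 0 := by
      apply inj; rw [K hs p, hx.jo_p, hy.jo_p, φ0, add_zero]
    obtain ⟨s1, sh, s0, g1, gh, g0, e⟩ := decomp hp s
    rw [e, add_jo, add_jo, g1.jo_p, gh.jo_p, g0.jo_p] at h1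
    obtain ⟨q2, q1, -⟩ := uniq g1 (gh.smul _) hz0 h1
    have q1 : sh = 0 := half (by rw [q1, smul_zero])
    rw [q1, q2, add_zero, zero_add] at e
    have : s0 = x + y := by
      refine sub_eq_zero.1 (F0 _ (g0.sub (hx.add hy)) fun t ht => ?_)
      have := K hs t
      have k1 := ht.jo_J0 hx
      have k2 := ht.jo_J0 hy
      rw [jo_comm] at k1 k2
      rw [← H _ _ k1 k2] at this
      have := inj this
      rw [sub_jo, ← e, this, add_jo, sub_self]
    rw [← hs, e, this]
  obtain ⟨a1, ah, a0, f1, fh, f0, rfl⟩ := decomp hp a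
  obtain ⟨b1, bh, b0, g1, gh, g0, rfl⟩ := decomp hp b
  have : a1 + ah + a0 + (b1 + bh + b0) = (a1 + b1) + (ah + bh) + (a0 + b0) := by abel
  rw [this, S3 _ _ _ (f1.add g1) (fh.add gh) (f0.add g0), S3 _ _ _ f1 fh f0, S3 _ _ _ g1 gh g0,
    A1 _ _ f1 g1, H _ _ fh gh, A0 _ _ f0 g0]
  abel

end abs

/-- additivity implies the compression identity -/
lemma compress {R S : Type*} [NonUnitalRing R] [Module ℂ R] [IsScalarTower ℂ R R]
    [SMulCommClass ℂ R R]
    [NonUnitalRing S] [Module ℂ S] [IsScalarTower ℂ S S] [SMulCommClass ℂ S S]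
    {φ : R → S} (hJ : ∀ a b, φ (jo a b) = jo (φ a) (φ b))
    (hadd : ∀ a b, φ (a + b) = φ a + φ b) (t p : R) (hp : p * p = p) :
    φ (p * t * p) = φ p * φ t * φ p := by
  have G {Q : Type _} [NonUnitalRing Q] [Module ℂ Q] [IsScalarTower ℂ Q Q]
      [SMulCommClass ℂ Q Q] (t p : Q) (hp : p * p = p) :
      p * t * p + jo p t = jo p (jo p t) + jo p (jo p t) := by
    have h1 (x : Q) : p * (p * x) = p * x := by rw [← mul_assoc, hp]
    simp only [jo, mul_add, add_mul, mul_smul_comm, smul_mul_assoc, mul_assoc, h1, hp]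
    module
  have G' {Q : Type _} [NonUnitalRing Q] [Module ℂ Q] [IsScalarTower ℂ Q Q]
      [SMulCommClass ℂ Q Q] (t p : Q) (hp : p * p = p) :
      p * t * p + jo p t = jo p (jo p t) + jo p (jo p t) := by
    have h1 (x : Q) : p * (p * x) = p * x := by rw [← mul_assoc, hp]
    simp only [jo, mul_add, add_mul, mul_smul_comm, smul_mul_assoc, mul_assoc, h1, hp]
    module
  have hφ : φ p * φ p = φ p := by
    have h := hJ p p
    have e1 : jo p p = p := by simp only [jo, hp]; module
    have e2 : jo (φ p) (φ p) = φ p * φ p := by simp only [jo]; module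
    rw [e1, e2] at h; exact h.symm
  have h := congrArg φ (G t p hp)
  rw [hadd, hadd, hJ p (jo p t), hJ p t, ← G' (φ t) (φ p) hφ] at h
  exact add_right_cancel h

end JMap

open JMap in
theorem jordan_map_compression_of_finite_rank
    {X Y : Type*} [NormedAddCommGroup X] [NormedSpace ℂ X] [CompleteSpace X]
    [NormedAddCommGroup Y] [NormedSpace ℂ Y] [CompleteSpace Y]
    (hX : 1 < Module.rank ℂ X)
    (𝒜 : NonUnitalSubalgebra ℂ (X →L[ℂ] X)) (ℬ : NonUnitalSubalgebra ℂ (Y →L[ℂ] Y))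
    (h𝒜 : ∀ T : X →L[ℂ] X, FiniteDimensional ℂ (LinearMap.range (T : X →ₗ[ℂ] X)) → T ∈ 𝒜)
    (hℬ : ∀ S : Y →L[ℂ] Y, FiniteDimensional ℂ (LinearMap.range (S : Y →ₗ[ℂ] Y)) → S ∈ ℬ)
    (φ : 𝒜 → ℬ) (hbij : Function.Bijective φ)
    (hJ : ∀ A B : 𝒜, φ (((1:ℂ)/2) • (A * B + B * A))
        = ((1:ℂ)/2) • (φ A * φ B + φ B * φ A)) :
    ∀ T P : 𝒜, FiniteDimensional ℂ (LinearMap.range ((T : X →L[ℂ] X) : X →ₗ[ℂ] X)) →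
      P * P = P → FiniteDimensional ℂ (LinearMap.range ((P : X →L[ℂ] X) : X →ₗ[ℂ] X)) →
      φ (P * T * P) = φ P * φ T * φ P := by
  intro T P _ hP _
  refine compress (φ := φ) hJ ?_ T P hP
  -- rank one operators
  have hmem : ∀ (f : X →L[ℂ] ℂ) (y : X), f.smulRight y ∈ 𝒜 := by
    intro f y
    apply h𝒜
    have : LinearMap.range ((f.smulRight y : X →L[ℂ] X) : X →ₗ[ℂ] X) ≤ Submodule.span ℂ {y} := by
      rintro _ ⟨x, rfl⟩
      exact Submodule.mem_span_singleton.2 ⟨f x, rfl⟩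
    exact Submodule.finiteDimensional_of_le this
  let r : (X →L[ℂ] ℂ) → X → 𝒜 := fun f y => ⟨f.smulRight y, hmem f y⟩
  have hr : ∀ f y x, (r f y : X →L[ℂ] X) x = f x • y := fun f y x => rfl
  have ext : ∀ {a b : 𝒜}, (∀ x, (a : X →L[ℂ] X) x = (b : X →L[ℂ] X) x) → a = b :=
    fun h => Subtype.ext (ContinuousLinearMap.ext h)
  have hmul : ∀ (a b : 𝒜) x, ((a * b : 𝒜) : X →L[ℂ] X) x = (a : X →L[ℂ] X) ((b : X →L[ℂ] X) x) :=
    fun a b x => rfl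
  have hadd : ∀ (a b : 𝒜) x, ((a + b : 𝒜) : X →L[ℂ] X) x = (a : X →L[ℂ] X) x + (b : X →L[ℂ] X) x :=
    fun a b x => rfl
  have hzero : ∀ x, ((0 : 𝒜) : X →L[ℂ] X) x = 0 := fun x => rfl
  have hap : ∀ {a b : 𝒜}, a = b → ∀ x, (a : X →L[ℂ] X) x = (b : X →L[ℂ] X) x := by
    rintro a b rfl x; rfl
  have hjo : ∀ {a b : 𝒜}, jo a b = 0 → ∀ x,
      (a : X →L[ℂ] X) ((b : X →L[ℂ] X) x) + (b : X →L[ℂ] X) ((a : X →L[ℂ] X) x) = 0 := by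
    intro a b h x
    have h2 : a * b + b * a = 0 := by
      have : ((1:ℂ)/2) • (a * b + b * a) = 0 := h
      exact (smul_eq_zero.1 this).resolve_left (by norm_num)
    exact hap h2 x
  have hjo2 : ∀ {a b : 𝒜}, a * b + b * a = a → jo a b = ((1:ℂ)/2) • a := by
    intro a b h
    simp only [jo, h]
  -- base vectors
  have hnt : Nontrivial X := rank_pos_iff_nontrivial.1 (lt_trans zero_lt_one hX)
  obtain ⟨x0, hx0⟩ := exists_ne (0 : X)
  have sep : ∀ y : X, y ≠ 0 → ∃ g : X →L[ℂ] ℂ, g y = 1 := fun y hy =>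
    SeparatingDual.exists_eq_one hy
  obtain ⟨f, hf⟩ := sep x0 hx0
  have hy0 : ∃ y, y ≠ 0 ∧ f y = 0 := by
    by_contra! hcon
    have : ∀ x : X, ∃ c : ℂ, c • x0 = x := by
      intro x
      refine ⟨f x, ?_⟩
      by_contra hne
      refine hcon (x - f x • x0) (sub_ne_zero.2 (Ne.symm hne)) ?_
      simp [hf]
    exact absurd (rank_le_one_iff.2 ⟨x0, this⟩) (not_le.2 hX)
  obtain ⟨y0, hy0, hfy0⟩ := hy0
  have sep2 : ∀ y : X, y ≠ 0 → f y = 0 → ∃ g : X →L[ℂ] ℂ, g y = 1 ∧ g x0 = 0 := by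
    intro y hy hfy
    obtain ⟨g, hg⟩ := sep y hy
    exact ⟨g - g x0 • f, by simp [hg, hfy], by simp [hf]⟩
  let p : 𝒜 := r f x0
  have hpx : ∀ x, (p : X →L[ℂ] X) x = f x • x0 := fun x => rfl
  have split : ∀ c : 𝒜, (c : X →L[ℂ] X) x0 = 0 → (∀ y, y ≠ 0 → f y = 0 → (c : X →L[ℂ] X) y = 0) →
      c = 0 := by
    intro c h1 h2
    apply ext
    intro x
    have h3 : (c : X →L[ℂ] X) (x - f x • x0) = 0 := by
      by_cases h : x - f x • x0 = 0
      · rw [h, map_zero]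
      · exact h2 _ h (by simp [hf])
    rw [map_sub, map_smul, h1, smul_zero, sub_zero] at h3
    rw [h3, hzero]
  have hr0 : ∀ (g : X →L[ℂ] ℂ) y, g x0 = 0 → f y = 0 → J0 p (r g y) := by
    intro g y hg hy
    constructor <;> apply ext <;> intro x <;> simp [hmul, hpx, hr, hg, hy, hzero]
  have hrh : ∀ y, f y = 0 → Jh p (r f y) := by
    intro y hy
    apply ext; intro x; simp [hadd, hmul, hpx, hr, hf, hy]
  have hrh' : ∀ g : X →L[ℂ] ℂ, g x0 = 0 → Jh p (r g x0) := by
    intro y hy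
    apply ext; intro x; simp [hadd, hmul, hpx, hr, hf, hy]
  have J0a : ∀ {c : 𝒜}, J0 p c → (c : X →L[ℂ] X) x0 = 0 ∧ ∀ x, f ((c : X →L[ℂ] X) x) = 0 := by
    intro c hc
    constructor
    · have := hap hc.2 x0
      simpa [hmul, hpx, hf, hzero] using this
    · intro x
      have := hap hc.1 x
      simpa [hmul, hpx, hx0, hzero] using this
  have Jha : ∀ {c : 𝒜}, Jh p c → f ((c : X →L[ℂ] X) x0) = 0 ∧
      ∀ y, f y = 0 → (c : X →L[ℂ] X) y = f ((c : X →L[ℂ] X) y) • x0 := by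
    intro c hc
    constructor
    · have := hap hc x0
      simpa [hadd, hmul, hpx, hf, hx0] using this
    · intro y hy
      have := hap hc y
      simpa [hadd, hmul, hpx, hy] using this.symm
  refine additive (φ := φ) hbij hJ (p := p) ?_ ?_ ?_ ?_ ?_ ?_
  · apply ext; intro x; simp [hmul, hpx, hf]
  · intro c hc ht
    have h1 := hjo (ht _ (hrh y0 hfy0)) x0
    have hcy : ∀ y, f y = 0 → (c : X →L[ℂ] X) y = 0 := by
      intro y hy
      have := hap hc.2 y
      simpa [hmul, hpx, hy] using this.symm
    have h2 : f ((c : X →L[ℂ] X) x0) = 0 := by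
      simpa [hr, hf, hcy y0 hfy0, hy0] using h1
    refine split c ?_ fun y _ hy => hcy y hy
    have := hap hc.1 x0
    simpa [hmul, hpx, h2] using this.symm
  · intro c hc ht
    refine split c (J0a hc).1 fun y _ hy => ?_
    have h1 := hjo (ht _ (hrh y hy)) x0
    simpa [hr, hf, (J0a hc).1] using h1
  · intro c hc ht
    refine split c ?_ fun y hy hfy => ?_
    · by_contra hne
      obtain ⟨g, hg1, hg0⟩ := sep2 _ hne (Jha hc).1
      have h1 := hjo (ht _ (hr0 g _ hg0 (Jha hc).1)) x0
      simp [hr, hg0, hg1] at h1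
      exact hne h1
    · obtain ⟨g, hg1, hg0⟩ := sep2 y hy hfy
      have h1 := hjo (ht _ (hr0 g y hg0 hfy)) y
      have h2 : g ((c : X →L[ℂ] X) y) = 0 := by
        rw [(Jha hc).2 y hfy]; simp [hg0]
      simpa [hr, hg1, h2] using h1
  · intro c hc ht
    refine split c (J0a hc).1 fun y hy hfy => ?_
    obtain ⟨g, hg1, hg0⟩ := sep2 y hy hfy
    have h1 := hjo (ht _ (hr0 g y hg0 hfy)) y
    have h2 : g ((c : X →L[ℂ] X) y) = 0 := by
      have := congrArg g h1
      simp [hr, hg1] at this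
      exact this
    simpa [hr, hg1, h2] using h1
  · intro a ha
    have e1 := (Jha ha).1
    set z := (a : X →L[ℂ] X) x0 with hz
    let g : X →L[ℂ] ℂ := f.comp (a : X →L[ℂ] X)
    have hg : ∀ x, g x = f ((a : X →L[ℂ] X) x) := fun x => rfl
    have hg0 : g x0 = 0 := e1
    have hu : ∃ u, J0 p u ∧ jo (r f z) u = ((1:ℂ)/2) • r f z := by
      by_cases h : z = 0
      · refine ⟨0, by simp [J0], hjo2 ?_⟩
        apply ext; intro x; simp [hr, h]
      · obtain ⟨k, hk1, hk0⟩ := sep2 z h e1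
        refine ⟨r k z, hr0 _ _ hk0 e1, hjo2 ?_⟩
        apply ext; intro x; simp [hr, hadd, hmul, e1, hk1]
    have hv : ∃ v, J0 p v ∧ jo (r g x0) v = ((1:ℂ)/2) • r g x0 := by
      by_cases h : g = 0
      · refine ⟨0, by simp [J0], hjo2 ?_⟩
        apply ext; intro x; simp [hr, h]
      · obtain ⟨w, hw⟩ : ∃ w, g w ≠ 0 := by
          by_contra! hcon
          exact h (ContinuousLinearMap.ext hcon)
        let y := (g w)⁻¹ • (w - f w • x0)
        have hy1 : g y = 1 := by simp [y, hg0, hw]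
        have hy2 : f y = 0 := by simp [y, hf]
        refine ⟨r g y, hr0 _ _ hg0 hy2, hjo2 ?_⟩
        apply ext; intro x; simp [hr, hadd, hmul, hy1, hg0]
    obtain ⟨u, hu, hu'⟩ := hu
    obtain ⟨v, hv, hv'⟩ := hv
    refine ⟨r f z, r g x0, u, v, hrh _ e1, hrh' _ hg0, hu, hv, ?_, hu', hv'⟩
    apply ext; intro x
    have := hap ha x
    rw [← this]
    simp [hadd, hmul, hpx, hr, hg, hz, add_comm]
end

section
/- Let X and Y be complex Banach spaces with dim X > 1, let 𝒜 ⊆ B(X) and ℬ ⊆ B(Y) be standard operator algebras, and let φ : 𝒜 → ℬ be a bijective transformation satisfying φ((1/2)(AB+BA)) = (1/2)(φ(A)φ(B)+φ(B)φ(A)) for all A, B ∈ 𝒜. Then there exists an injective function h : ℂ → ℂ which is both multiplicative (h(λμ) = h(λ)h(μ) for all λ, μ ∈ ℂ) and additive (h(λ+μ) = h(λ)+h(μ) for all λ, μ ∈ ℂ) such that φ(λA) = h(λ)φ(A) for every λ ∈ ℂ and every finite rank operator A ∈ F(X). -/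
/-- The Jordan product. -/
noncomputable def jp {R : Type*} [NonUnitalRing R] [Module ℂ R] (a b : R) : R :=
  ((1:ℂ)/2) • (a * b + b * a)

section abs
set_option linter.unusedSectionVars false
variable {R : Type*} [NonUnitalRing R] [Module ℂ R] [IsScalarTower ℂ R R] [SMulCommClass ℂ R R]

theorem jp_comm (a b : R) : jp a b = jp b a := by
  simp [jp, add_comm]

theorem jp_add (a b c : R) : jp a (b + c) = jp a b + jp a c := by
  simp only [jp, mul_add, add_mul, smul_add]; abel

theorem jp_smul (a b : R) (c : ℂ) : jp a (c • b) = c • jp a b := by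
  simp only [jp, mul_smul_comm, smul_mul_assoc, smul_add, smul_smul, mul_comm]

theorem smul_jp (a b : R) (c : ℂ) : jp (c • a) b = c • jp a b := by
  rw [jp_comm, jp_smul, jp_comm]

theorem add_jp (a b c : R) : jp (a + b) c = jp a c + jp b c := by
  rw [jp_comm, jp_add, jp_comm c, jp_comm c]

theorem jp_sub (a b c : R) : jp a (b - c) = jp a b - jp a c := by
  simp only [jp, mul_sub, sub_mul, ← smul_sub]; congr 1; abel

theorem jp_zero (a : R) : jp a 0 = 0 := by simp [jp]

theorem jp_self (a : R) : jp a a = a * a := by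
  rw [jp, ← two_smul ℂ, smul_smul]; norm_num

theorem jp_eigen {q n : R} {c : ℂ} (hq : q * q = q) (hn : n ≠ 0) (h0 : c ≠ 0) (h1 : c ≠ 1)
    (h : jp q n = c • n) : c = 1/2 := by
  have e : q * n + n * q = (2 * c) • n := by
    have := congrArg (fun z => (2:ℂ) • z) h
    simpa [jp, smul_smul] using this
  have e1 : q * n + q * n * q = (2 * c) • (q * n) := by
    have := congrArg (fun z => q * z) e
    simpa [mul_add, ← mul_assoc, hq, mul_smul_comm] using this
  have e2 : q * n * q + n * q = (2 * c) • (n * q) := by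
    have := congrArg (fun z => z * q) e
    simpa [add_mul, mul_assoc, hq, smul_mul_assoc] using this
  by_contra hc
  have hc' : (2 * c - 1) ≠ 0 := by
    intro h; apply hc; linear_combination h/2
  have e3 : (2 * c - 1) • (q * n) = (2 * c - 1) • (n * q) := by
    rw [sub_smul, sub_smul, ← e1, ← e2]; simp
  have e4 : q * n = n * q := smul_right_injective R hc' e3
  have e5 : q * n = c • n := by
    rw [← e4, ← two_smul ℂ, mul_smul] at e
    exact smul_right_injective R (two_ne_zero) e
  have e6 : c • (c • n) = c • n := by
    rw [← e5, ← mul_smul_comm, ← e5, ← mul_assoc, hq]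
  have e7 : c • n = n := smul_right_injective R h0 e6
  have : (c - 1) • n = 0 := by rw [sub_smul, e7]; simp
  rcases smul_eq_zero.1 this with h | h
  · exact h1 (sub_eq_zero.1 h)
  · exact hn h

theorem jp_peirce {q t : R} (hq : q * q = q) (h : jp q t = t) : t = q * t * q := by
  have e : q * t + t * q = (2 : ℂ) • t := by
    have := congrArg (fun z => (2:ℂ) • z) h
    simpa [jp, smul_smul] using this
  rw [two_smul] at e
  have e1 : q * t + q * t * q = q * t + q * t := by
    have := congrArg (fun z => q * z) e
    simpa [mul_add, ← mul_assoc, hq] using this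
  have e2 : q * t * q + t * q = t * q + t * q := by
    have := congrArg (fun z => z * q) e
    simpa [add_mul, mul_assoc, hq] using this
  have e3 := add_left_cancel e1
  have e4 := add_right_cancel e2
  rw [← e3, ← e4, ← two_smul ℂ, ← two_smul ℂ] at e
  exact (smul_right_injective R (two_ne_zero (α := ℂ)) e).symm

end abs

section ops
variable {X : Type*} [NormedAddCommGroup X] [NormedSpace ℂ X]
  {𝒜 : NonUnitalSubalgebra ℂ (X →L[ℂ] X)}

/-- rank one idempotents -/
def R1 (A : 𝒜) : Prop := ∃ (x : X) (f : X →L[ℂ] ℂ), f x = 1 ∧ (A : X →L[ℂ] X) = f.smulRight x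

theorem R1.idem {A : 𝒜} (h : R1 A) : A * A = A := by
  obtain ⟨x, f, h1, h2⟩ := h
  ext z
  simp [h2, h1]

theorem R1.ne_zero {A : 𝒜} (h : R1 A) : A ≠ 0 := by
  obtain ⟨x, f, h1, h2⟩ := h
  rintro rfl
  have := congrArg (fun T : X →L[ℂ] X => f (T x)) h2
  simp [h1] at this

theorem R1.peirce {A T : 𝒜} (h : R1 A) (hT : jp A T = T) : ∃ c : ℂ, T = c • A := by
  have := jp_peirce h.idem hT
  obtain ⟨x, f, h1, h2⟩ := h
  refine ⟨f ((T : X →L[ℂ] X) x), ?_⟩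
  rw [this]
  ext z
  simp [h2, h1, smul_smul, mul_comm]

theorem fin_smulRight (f : X →L[ℂ] ℂ) (x : X) :
    FiniteDimensional ℂ (LinearMap.range ((f.smulRight x : X →L[ℂ] X) : X →ₗ[ℂ] X)) := by
  have : LinearMap.range ((f.smulRight x : X →L[ℂ] X) : X →ₗ[ℂ] X) ≤ ℂ ∙ x := by
    rintro _ ⟨z, rfl⟩
    simp only [ContinuousLinearMap.coe_coe, ContinuousLinearMap.smulRight_apply]
    exact Submodule.smul_mem _ _ (Submodule.mem_span_singleton_self x)
  exact Submodule.finiteDimensional_of_le this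

theorem jp_R1_zero
    (h𝒜 : ∀ T : X →L[ℂ] X, FiniteDimensional ℂ (LinearMap.range (T : X →ₗ[ℂ] X)) → T ∈ 𝒜)
    (S : 𝒜) (h : ∀ Q : 𝒜, R1 Q → jp S Q = 0) : S = 0 := by
  ext x
  by_cases hx : x = 0
  · simp [hx]
  obtain ⟨f, hf⟩ := SeparatingDual.exists_eq_one (R := ℂ) hx
  have := h ⟨f.smulRight x, h𝒜 _ (fin_smulRight f x)⟩ ⟨x, f, hf, rfl⟩
  have h1 := congrArg (fun T : 𝒜 => (T : X →L[ℂ] X) x) this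
  simp only [jp] at h1
  simp [hf] at h1
  have h2 : f ((S : X →L[ℂ] X) x) = 0 := by
    have := congrArg f h1
    simp [hf] at this
    exact this
  simpa [h2] using h1

theorem jp_ne {P K : 𝒜} {x u : X} {f k : X →L[ℂ] ℂ} (hx : x ≠ 0)
    (hP : (P : X →L[ℂ] X) = f.smulRight x) (hK : (K : X →L[ℂ] X) = k.smulRight u)
    (hku : k u = 1) (hfu : f u ≠ 0) : jp P K ≠ 0 := by
  intro h
  have h1 := congrArg (fun T : 𝒜 => (T : X →L[ℂ] X) u) h
  simp only [jp] at h1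
  simp [hP, hK, hku] at h1
  have h3 : x + k x • u = 0 := by
    have : f u • (x + k x • u) = 0 := by
      rw [← smul_add] at h1
      rw [smul_add]
      exact (smul_eq_zero.1 h1).resolve_left (by norm_num)
    exact (smul_eq_zero.1 this).resolve_left hfu
  have h4 : k x = 0 := by
    have := congrArg k h3
    simp [hku] at this
    exact this
  apply hx
  simpa [h4] using h3

theorem R1.connect
    (h𝒜 : ∀ T : X →L[ℂ] X, FiniteDimensional ℂ (LinearMap.range (T : X →ₗ[ℂ] X)) → T ∈ 𝒜)
    {P P' : 𝒜} (h : R1 P) (h' : R1 P') : ∃ K : 𝒜, R1 K ∧ jp P K ≠ 0 ∧ jp P' K ≠ 0 := by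
  obtain ⟨x, f, hf, hP⟩ := h
  obtain ⟨y, g, hg, hP'⟩ := h'
  have hx : x ≠ 0 := by rintro rfl; simp at hf
  have hy : y ≠ 0 := by rintro rfl; simp at hg
  have : ∃ u, f u ≠ 0 ∧ g u ≠ 0 := by
    by_cases h1 : f y = 0
    · by_cases h2 : g x = 0
      · exact ⟨x + y, by simp [hf, h1], by simp [hg, h2]⟩
      · exact ⟨x, by simp [hf], h2⟩
    · exact ⟨y, h1, by simp [hg]⟩
  obtain ⟨u, hu1, hu2⟩ := this
  have hu : u ≠ 0 := by rintro rfl; simp at hu1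
  obtain ⟨k, hk⟩ := SeparatingDual.exists_eq_one (R := ℂ) hu
  exact ⟨⟨k.smulRight u, h𝒜 _ (fin_smulRight k u)⟩, ⟨u, k, hk, rfl⟩,
    jp_ne hx hP rfl hk hu1, jp_ne hy hP' rfl hk hu2⟩

theorem exists_dual (hX : 1 < Module.rank ℂ X) : ∃ (x y : X) (f g : X →L[ℂ] ℂ),
    f x = 1 ∧ f y = 0 ∧ g x = 0 ∧ g y = 1 := by
  have : Nontrivial X := by
    by_contra hn
    rw [not_nontrivial_iff_subsingleton] at hn
    rw [rank_subsingleton'] at hX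
    exact absurd hX (by simp)
  obtain ⟨x, hx⟩ := exists_ne (0 : X)
  obtain ⟨f, hf⟩ := SeparatingDual.exists_eq_one (R := ℂ) hx
  have : ∃ z, z ∉ (ℂ ∙ x) := by
    by_contra! hc
    have : (ℂ ∙ x) = ⊤ := Submodule.eq_top_iff'.2 hc
    have h2 := rank_span_le (R := ℂ) ({x} : Set X)
    rw [this, rank_top] at h2
    simp at h2
    exact absurd hX (not_lt.2 h2)
  obtain ⟨z, hz⟩ := this
  have hy : z - f z • x ≠ 0 := by
    intro h
    rw [sub_eq_zero] at h
    exact hz (h ▸ Submodule.smul_mem _ _ (Submodule.mem_span_singleton_self x))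
  obtain ⟨g, hg⟩ := SeparatingDual.exists_eq_one (R := ℂ) hy
  have hfy : f (z - f z • x) = 0 := by simp [hf]
  refine ⟨x, z - f z • x, f, g - g x • f, hf, hfy, ?_, ?_⟩
  · simp [hf]
  · rw [sub_apply, smul_apply, hfy, hg]; simp

end ops

section two
variable {X Y : Type*} [NormedAddCommGroup X] [NormedSpace ℂ X]
  [NormedAddCommGroup Y] [NormedSpace ℂ Y]
  {𝒜 : NonUnitalSubalgebra ℂ (X →L[ℂ] X)} {ℬ : NonUnitalSubalgebra ℂ (Y →L[ℂ] Y)}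

theorem map_zero_jp (e : 𝒜 ≃ ℬ) (hJ : ∀ A B, e (jp A B) = jp (e A) (e B)) : e 0 = 0 := by
  have := hJ 0 (e.symm 0)
  rw [jp_comm, jp_zero, e.apply_symm_apply, jp_zero] at this
  exact this

theorem symm_jp (e : 𝒜 ≃ ℬ) (hJ : ∀ A B, e (jp A B) = jp (e A) (e B)) (A B : ℬ) :
    e.symm (jp A B) = jp (e.symm A) (e.symm B) := by
  apply e.injective
  rw [hJ]; simp

theorem R1_map
    (hℬ : ∀ S : Y →L[ℂ] Y, FiniteDimensional ℂ (LinearMap.range (S : Y →ₗ[ℂ] Y)) → S ∈ ℬ)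
    (e : 𝒜 ≃ ℬ) (hJ : ∀ A B, e (jp A B) = jp (e A) (e B)) {P : 𝒜} (hP : R1 P) : R1 (e P) := by
  have hid : e P * e P = e P := by
    rw [← jp_self, ← hJ, jp_self, hP.idem]
  have hne : e P ≠ 0 := by
    rw [← map_zero_jp e hJ]
    exact fun h => hP.ne_zero (e.injective h)
  have : ∃ z, (e P : Y →L[ℂ] Y) z ≠ 0 := by
    by_contra! hc
    apply hne
    ext z
    simpa using hc z
  obtain ⟨z, hz⟩ := this
  have hidz : ∀ w, (e P : Y →L[ℂ] Y) ((e P : Y →L[ℂ] Y) w) = (e P : Y →L[ℂ] Y) w := by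
    intro w
    exact congrArg (fun T : ℬ => (T : Y →L[ℂ] Y) w) hid
  set y := (e P : Y →L[ℂ] Y) z with hy
  obtain ⟨g, hg⟩ := SeparatingDual.exists_eq_one (R := ℂ) hz
  have hyy : (e P : Y →L[ℂ] Y) y = y := hidz z
  let k : Y →L[ℂ] ℂ := g.comp (e P : Y →L[ℂ] Y)
  have hk : k y = 1 := by simp [k, hyy, hg]
  let Q : ℬ := ⟨k.smulRight y, hℬ _ (fin_smulRight k y)⟩
  have hQ : R1 Q := ⟨y, k, hk, rfl⟩
  have hQP : jp (e P) Q = Q := by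
    have h1 : e P * Q = Q := by
      ext w; simp [Q, hyy]
    have h2 : Q * e P = Q := by
      ext w; simp [Q, k, hidz]
    rw [jp, h1, h2, ← two_smul ℂ, smul_smul]; norm_num
  have h3 : jp P (e.symm Q) = e.symm Q := by
    have := symm_jp e hJ (e P) Q
    rw [hQP, e.symm_apply_apply] at this
    exact this.symm
  obtain ⟨c, hc⟩ := hP.peirce h3
  have h4 : e.symm Q * e.symm Q = e.symm Q := by
    rw [← jp_self, ← symm_jp e hJ, jp_self, hQ.idem]
  have h5 : e.symm Q ≠ 0 := by
    intro h
    apply hQ.ne_zero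
    rw [← e.apply_symm_apply Q, h, map_zero_jp e hJ]
  have hc0 : c ≠ 0 := by
    rintro rfl
    rw [zero_smul] at hc
    exact h5 hc
  have hc1 : c = 1 := by
    rw [hc, smul_mul_smul_comm, hP.idem] at h4
    have := smul_left_injective ℂ hP.ne_zero h4
    simpa [hc0] using this
  rw [hc1, one_smul] at hc
  rw [← hc, e.apply_symm_apply]
  exact hQ

theorem exists_h
    (h𝒜 : ∀ T : X →L[ℂ] X, FiniteDimensional ℂ (LinearMap.range (T : X →ₗ[ℂ] X)) → T ∈ 𝒜)
    (hℬ : ∀ S : Y →L[ℂ] Y, FiniteDimensional ℂ (LinearMap.range (S : Y →ₗ[ℂ] Y)) → S ∈ ℬ)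
    (e : 𝒜 ≃ ℬ) (hJ : ∀ A B, e (jp A B) = jp (e A) (e B)) {P₀ : 𝒜} (hP₀ : R1 P₀) :
    ∃ h : ℂ → ℂ, ∀ (c : ℂ) (A : 𝒜), e (c • A) = h c • e A := by
  have key : ∀ P : 𝒜, R1 P → ∃ h : ℂ → ℂ, ∀ c, e (c • P) = h c • e P := by
    intro P hP
    have : ∀ c : ℂ, ∃ d : ℂ, e (c • P) = d • e P := by
      intro c
      apply (R1_map hℬ e hJ hP).peirce
      rw [← hJ, jp_smul, jp_self, hP.idem]
    choose h hh using this
    exact ⟨h, hh⟩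
  choose! H hH using key
  have link : ∀ P K : 𝒜, R1 P → R1 K → jp P K ≠ 0 → H P = H K := by
    intro P K hP hK hne
    funext c
    have h1 : e (c • jp P K) = H P c • jp (e P) (e K) := by
      rw [← smul_jp, hJ, hH P hP, smul_jp]
    have h2 : e (c • jp P K) = H K c • jp (e P) (e K) := by
      rw [← jp_smul, hJ, hH K hK, jp_smul]
    have h3 : jp (e P) (e K) ≠ 0 := by
      rw [← hJ, ← map_zero_jp e hJ]
      exact fun h => hne (e.injective h)
    exact smul_left_injective ℂ h3 (h1.symm.trans h2)
  have all : ∀ P : 𝒜, R1 P → H P = H P₀ := by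
    intro P hP
    obtain ⟨K, hK, k1, k2⟩ := hP.connect h𝒜 hP₀
    rw [link P K hP hK k1, link P₀ K hP₀ hK k2]
  refine ⟨H P₀, fun c A => ?_⟩
  rw [← sub_eq_zero]
  apply jp_R1_zero hℬ
  intro Q hQ
  have hP : R1 (e.symm Q) := R1_map h𝒜 e.symm (symm_jp e hJ) hQ
  have hh := hH _ hP c
  rw [e.apply_symm_apply, all _ hP] at hh
  rw [jp_comm, jp_sub, jp_smul, sub_eq_zero, jp_comm Q, jp_comm Q]
  nth_rewrite 1 [← e.apply_symm_apply Q]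
  rw [← hJ, smul_jp, ← jp_smul, hJ, hh, jp_smul]

end two

set_option maxHeartbeats 2000000 in
theorem jordan_map_ring_automorphism_homogeneity
    {X Y : Type*} [NormedAddCommGroup X] [NormedSpace ℂ X] [CompleteSpace X]
    [NormedAddCommGroup Y] [NormedSpace ℂ Y] [CompleteSpace Y]
    (hX : 1 < Module.rank ℂ X)
    (𝒜 : NonUnitalSubalgebra ℂ (X →L[ℂ] X)) (ℬ : NonUnitalSubalgebra ℂ (Y →L[ℂ] Y))
    (h𝒜 : ∀ T : X →L[ℂ] X, FiniteDimensional ℂ (LinearMap.range (T : X →ₗ[ℂ] X)) → T ∈ 𝒜)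
    (hℬ : ∀ S : Y →L[ℂ] Y, FiniteDimensional ℂ (LinearMap.range (S : Y →ₗ[ℂ] Y)) → S ∈ ℬ)
    (φ : 𝒜 → ℬ) (hbij : Function.Bijective φ)
    (hJ : ∀ A B : 𝒜, φ (((1:ℂ)/2) • (A * B + B * A))
        = ((1:ℂ)/2) • (φ A * φ B + φ B * φ A)) :
    ∃ h : ℂ → ℂ, Function.Injective h ∧
      (∀ lam mu : ℂ, h (lam * mu) = h lam * h mu) ∧
      (∀ lam mu : ℂ, h (lam + mu) = h lam + h mu) ∧
      ∀ (lam : ℂ) (A : 𝒜), FiniteDimensional ℂ (LinearMap.range ((A : X →L[ℂ] X) : X →ₗ[ℂ] X)) →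
        φ (lam • A) = h lam • φ A := by
  obtain ⟨e, rfl⟩ : ∃ e : 𝒜 ≃ ℬ, φ = e.toFun := ⟨Equiv.ofBijective φ hbij, rfl⟩
  replace hJ : ∀ A B : 𝒜, e (jp A B) = jp (e A) (e B) := hJ
  change ∃ h : ℂ → ℂ, Function.Injective h ∧
      (∀ lam mu : ℂ, h (lam * mu) = h lam * h mu) ∧
      (∀ lam mu : ℂ, h (lam + mu) = h lam + h mu) ∧
      ∀ (lam : ℂ) (A : 𝒜), FiniteDimensional ℂ (LinearMap.range ((A : X →L[ℂ] X) : X →ₗ[ℂ] X)) →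
        e (lam • A) = h lam • e A
  obtain ⟨x, y, f, g, hfx, hfy, hgx, hgy⟩ := exists_dual hX
  let P : 𝒜 := ⟨f.smulRight x, h𝒜 _ (fin_smulRight f x)⟩
  let P' : 𝒜 := ⟨g.smulRight y, h𝒜 _ (fin_smulRight g y)⟩
  let N : 𝒜 := ⟨g.smulRight x, h𝒜 _ (fin_smulRight g x)⟩
  have hP : R1 P := ⟨x, f, hfx, rfl⟩
  have hP' : R1 P' := ⟨y, g, hgy, rfl⟩
  have hx : x ≠ 0 := by rintro rfl; simp at hfx
  have hN : N ≠ 0 := by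
    intro h
    have := congrArg (fun T : 𝒜 => (T : X →L[ℂ] X) y) h
    simp [N, hgy, hx] at this
  have mPN : P * N = N := by ext w; simp [P, N, hfx]
  have mNP : N * P = 0 := by ext w; simp [P, N, hgx]
  have mNN : N * N = 0 := by ext w; simp [N, hgx]
  have mP'N : P' * N = 0 := by ext w; simp [P', N, hgx]
  have mNP' : N * P' = N := by ext w; simp [P', N, hgy]
  have mPP' : P * P' = 0 := by ext w; simp [P', P, hfy]
  have mP'P : P' * P = 0 := by ext w; simp [P', P, hgx]
  have jPN : jp P N = ((1:ℂ)/2) • N := by rw [jp, mPN, mNP, add_zero]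
  have jP'N : jp P' N = ((1:ℂ)/2) • N := by rw [jp, mP'N, mNP', zero_add]
  have jPP' : jp P P' = 0 := by rw [jp, mPP', mP'P]; simp
  have jNN : jp N N = 0 := by rw [jp_self, mNN]
  have jPPs : jp P P = P := by rw [jp_self, hP.idem]
  have jPPs' : jp P' P' = P' := by rw [jp_self, hP'.idem]
  obtain ⟨h, hh⟩ := exists_h h𝒜 hℬ e hJ hP
  have hQ := R1_map hℬ e hJ hP
  have hz := map_zero_jp e hJ
  have hN' : e N ≠ 0 := by
    rw [← hz]; exact fun h => hN (e.injective h)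
  have hinj : Function.Injective h := by
    intro a b hab
    have : e (a • P) = e (b • P) := by rw [hh, hh, hab]
    exact smul_left_injective ℂ hP.ne_zero (e.injective this)
  have hmul : ∀ a b, h (a * b) = h a * h b := by
    intro a b
    apply smul_left_injective ℂ hQ.ne_zero
    simp only
    rw [← hh, mul_smul, hh, hh, smul_smul]
  have h0 : h 0 = 0 := by
    have := hh 0 P
    rw [zero_smul, hz] at this
    exact (smul_eq_zero.1 this.symm).resolve_right hQ.ne_zero
  have h1 : h 1 = 1 := by
    apply smul_left_injective ℂ hQ.ne_zero
    simp only
    rw [← hh, one_smul, one_smul]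
  have eQN : jp (e P) (e N) = h (1/2) • e N := by rw [← hJ, jPN, hh]
  have hhalf : h (1/2) = 1/2 := by
    apply jp_eigen hQ.idem hN' _ _ eQN
    · intro h'
      have := hinj (h'.trans h0.symm)
      norm_num at this
    · intro h'
      have := hinj (h'.trans h1.symm)
      norm_num at this
  rw [hhalf] at eQN
  have eNN : jp (e N) (e N) = 0 := by rw [← hJ, jNN, hz]
  have eQQ' : jp (e P) (e P') = 0 := by rw [← hJ, jPP', hz]
  have eQQ : jp (e P) (e P) = e P := by rw [← hJ, jPPs]
  have eQQs' : jp (e P') (e P') = e P' := by rw [← hJ, jPPs']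
  have hU : e (P + P') = e P + e P' := by
    have a1 : jp (e.symm (e P + e P')) P = P := by
      apply e.injective
      rw [hJ, e.apply_symm_apply, add_jp, eQQ, jp_comm (e P'), eQQ', add_zero]
    have a2 : jp (e.symm (e P + e P')) P' = P' := by
      apply e.injective
      rw [hJ, e.apply_symm_apply, add_jp, eQQ', eQQs', zero_add]
    have a3 : jp (e P + e P') (e (P + P')) = e (P + P') := by
      have := congrArg e (jp_add (e.symm (e P + e P')) P P')
      rwa [a1, a2, hJ, e.apply_symm_apply] at this
    have b1 : jp (e (P + P')) (e P) = e P := by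
      rw [← hJ, add_jp, jPPs, jp_comm P', jPP', add_zero]
    have b2 : jp (e (P + P')) (e P') = e P' := by
      rw [← hJ, add_jp, jPPs', jPP', zero_add]
    rw [← a3, jp_comm, jp_add, b1, b2]
  have hR : ∀ a : ℂ, e (P + a • N) = e P + h a • e N := by
    intro a
    by_cases ha : a = 0
    · simp [ha, h0]
    have hha : h a ≠ 0 := by rw [← h0]; exact fun h => ha (hinj h)
    set T := e (P + a • N) with hT
    have t1 : jp T (e P + e P') = T := by
      rw [← hU, hT, ← hJ]
      congr 1
      rw [jp_comm, jp_add, jp_smul, add_jp, add_jp, jPN, jP'N, jPPs, jp_comm P', jPP', add_zero,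
        ← add_smul]
      norm_num
    have t2 : jp T (e P') = (1/2 * h a) • e N := by
      rw [hT, ← hJ, jp_comm, jp_add, jp_smul, jP'N, jp_comm P', jPP', zero_add, smul_smul, hh, hmul,
        hhalf, mul_comm]
    have t3 : jp T T = T := by
      rw [hT, ← hJ]
      congr 1
      rw [jp_add, add_jp, add_jp, jp_smul, jp_smul, smul_jp, smul_jp, jNN, jp_comm N P, jPN, jPPs,
        smul_zero, smul_zero, add_zero, add_assoc, ← smul_add, ← add_smul]
      norm_num
    have t4 : jp (e P) (T - h a • e N) = T - h a • e N := by
      rw [jp_add, t2] at t1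
      rw [jp_sub, jp_smul, eQN, jp_comm, eq_sub_of_add_eq t1, smul_smul, sub_sub, ← add_smul]
      congr 2; ring
    obtain ⟨d, hd⟩ := hQ.peirce t4
    have t5 : T = d • e P + h a • e N := by rw [← hd]; abel
    have t6 : (d * d) • e P + (d * h a) • e N = d • e P + h a • e N := by
      rw [t5] at t3
      rw [← t3]
      simp only [jp_add, add_jp, jp_smul, smul_jp, eNN, eQQ, eQN, jp_comm (e N) (e P), smul_smul,
        smul_add, smul_zero, add_zero]
      rw [add_assoc, ← add_smul]
      congr 2; ring
    -- apply the Jordan product with `e P`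
    have t7 := congrArg (fun z => jp (e P) z) t6
    simp only [jp_add, jp_smul, eQQ, eQN, smul_smul] at t7
    have t8 : (d * h a * (1/2)) • e N = (h a * (1/2)) • e N := by
      have := congrArg₂ (fun u v => u - v) t6 t7
      simp only [add_sub_add_left_eq_sub, ← sub_smul] at this
      convert this using 2 <;> ring
    have t9 := smul_left_injective ℂ hN' t8
    have hd1 : d = 1 := by
      have : h a * (d - 1) = 0 := by
        linear_combination 2 * t9
      exact sub_eq_zero.1 ((mul_eq_zero.1 this).resolve_left hha)
    rw [t5, hd1, one_smul]
  have hmid : ∀ a b, h (1/2 * (a + b)) = 1/2 * (h a + h b) := by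
    intro a b
    have h3 : jp (P + a • N) (P + b • N) = P + (1/2 * (a + b)) • N := by
      simp only [jp_add, add_jp, jp_smul, smul_jp, jNN, jPPs, jPN, jp_comm N P, smul_smul,
        smul_zero, add_zero]
      rw [add_assoc, ← add_smul]
      congr 2; ring
    have h4 := hJ (P + a • N) (P + b • N)
    rw [h3, hR, hR, hR] at h4
    simp only [jp_add, add_jp, jp_smul, smul_jp, eNN, eQQ, eQN, jp_comm (e N) (e P), smul_smul,
        smul_zero, add_zero] at h4
    rw [add_assoc, ← add_smul] at h4
    have h5 := smul_left_injective ℂ hN' (add_left_cancel h4)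
    rw [h5]; ring
  refine ⟨h, hinj, hmul, ?_, fun c A _ => hh c A⟩
  intro a b
  have := hmid a b
  rw [hmul, hhalf] at this
  linear_combination 2 * this
end

section
/- Let X and Y be complex Banach spaces with dim X > 1, let 𝒜 ⊆ B(X) and ℬ ⊆ B(Y) be standard operator algebras, and let φ : 𝒜 → ℬ be a bijective transformation satisfying φ((1/2)(AB+BA)) = (1/2)(φ(A)φ(B)+φ(B)φ(A)) for all A, B ∈ 𝒜. Then φ is additive on the finite rank operators: φ(A+B) = φ(A)+φ(B) for all A, B ∈ F(X). -/
/-! Peirce decomposition argument: the map is additive on the whole algebra. -/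

/-- Peirce component membership: `true` is the corner of `e`. -/
def PC {R : Type*} [NonUnitalRing R] (e : R) (i j : Bool) (x : R) : Prop :=
  (e * x = if i then x else 0) ∧ (x * e = if j then x else 0)

/-- Faithfulness hypotheses on an idempotent. -/
structure GoodIdem {R : Type*} [NonUnitalRing R] (e : R) : Prop where
  tf : ∀ x : R, x + x = 0 → x = 0
  idem : e * e = e
  a1 : ∀ x : R, e * x = 0 → (∀ t, PC e true false t → t * x = 0) → x = 0
  a2 : ∀ x : R, x * e = 0 → (∀ t, PC e false true t → x * t = 0) → x = 0
  b1 : ∀ x : R, x * e = x → (∀ t, PC e true false t → x * t = 0) → x = 0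
  c1 : ∀ x : R, e * x = 0 → (∀ t, PC e false false t → t * x = 0) → x = 0
  c2 : ∀ x : R, x * e = 0 → (∀ t, PC e false false t → x * t = 0) → x = 0
  d1 : ∀ x : R, PC e false false x → (∀ t, PC e false false t → t * x + x * t = 0) → x = 0
  e1 : ∀ a : R, PC e true false a → ∃ f, PC e false false f ∧ a * f = a
  e2 : ∀ a : R, PC e false true a → ∃ f, PC e false false f ∧ f * a = a

namespace PC
variable {R : Type*} [NonUnitalRing R] {e : R}

theorem add {i j : Bool} {x y : R} (hx : PC e i j x) (hy : PC e i j y) : PC e i j (x + y) := by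
  obtain ⟨h1, h2⟩ := hx
  obtain ⟨h3, h4⟩ := hy
  refine ⟨?_, ?_⟩
  · rw [mul_add, h1, h3]; split <;> simp
  · rw [add_mul, h2, h4]; split <;> simp

theorem mul {i j l : Bool} {x y : R} (hx : PC e i j x) (hy : PC e j l y) : PC e i l (x * y) := by
  obtain ⟨h1, h2⟩ := hx
  obtain ⟨h3, h4⟩ := hy
  refine ⟨?_, ?_⟩
  · rw [← mul_assoc, h1]; split <;> simp
  · rw [mul_assoc, h4]; split <;> simp

theorem tf {i l : Bool} {x y : R} (hx : PC e i true x) (hy : PC e false l y) : x * y = 0 := by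
  have h1 : x * e = x := by simpa using hx.2
  have h2 : e * y = 0 := by simpa using hy.1
  rw [← h1, mul_assoc, h2, mul_zero]

theorem ft {i l : Bool} {x y : R} (hx : PC e i false x) (hy : PC e true l y) : x * y = 0 := by
  have h1 : x * e = 0 := by simpa using hx.2
  have h2 : e * y = y := by simpa using hy.1
  rw [← h2, ← mul_assoc, h1, zero_mul]

theorem le {j : Bool} {x : R} (hx : PC e true j x) : e * x = x := by simpa using hx.1
theorem lz {j : Bool} {x : R} (hx : PC e false j x) : e * x = 0 := by simpa using hx.1
theorem re {j : Bool} {x : R} (hx : PC e j true x) : x * e = x := by simpa using hx.2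
theorem rz {j : Bool} {x : R} (hx : PC e j false x) : x * e = 0 := by simpa using hx.2

end PC

namespace GoodIdem
variable {R : Type*} [NonUnitalRing R] {e : R} (g : GoodIdem e)

/-- The condition that `d` Jordan-annihilates the `(i,j)` Peirce component. -/
def Ann (e : R) (i j : Bool) (d : R) : Prop := ∀ t, PC e i j t → t * d + d * t = 0

include g

theorem E {d : R} (h : e * d + d * e = 0) : e * d = 0 ∧ d * e = 0 := by
  have hi := g.idem
  have h1 : e * d + e * d * e = 0 := by
    have := congrArg (e * ·) h
    simpa [mul_add, ← mul_assoc, hi] using this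
  have h2 : e * d * e + d * e = 0 := by
    have := congrArg (· * e) h
    simpa [add_mul, mul_assoc, hi] using this
  have h3 : e * d * e = 0 := by
    apply g.tf
    have := congrArg (· * e) h1
    simpa [add_mul, mul_assoc, hi] using this
  rw [h3] at h1 h2
  exact ⟨by simpa using h1, by simpa using h2⟩

theorem T22 {d : R} (h : Ann e false false d) : e * d = d ∧ d * e = d := by
  have hi := g.idem
  -- component 21
  have k1 : d * e - e * d * e = 0 := by
    apply g.c1
    · simp [mul_sub, ← mul_assoc, hi]
    · intro t ht
      have := congrArg (· * e) (h t ht)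
      simp only [add_mul, mul_assoc, ht.rz, mul_zero, add_zero, zero_mul] at this
      rw [mul_sub, ← mul_assoc t (e * d), ← mul_assoc t e d, ht.rz, this]; simp
  have k2 : e * d - e * d * e = 0 := by
    apply g.c2
    · simp [sub_mul, mul_assoc, hi]
    · intro t ht
      have := congrArg (e * ·) (h t ht)
      simp only [mul_add, ← mul_assoc, ht.lz, zero_mul, zero_add, mul_zero] at this
      rw [sub_mul, mul_assoc (e * d) e t, ht.lz, this]; simp
  have k1' : d * e = e * d * e := sub_eq_zero.1 k1
  have k2' : e * d = e * d * e := sub_eq_zero.1 k2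
  have k3 : d - e * d = 0 := by
    apply g.d1
    · refine ⟨?_, ?_⟩
      · simp [mul_sub, ← mul_assoc, hi]
      · simp [sub_mul, k1']
    · intro t ht
      have h1 : t * (e * d) = 0 := by rw [← mul_assoc, ht.rz, zero_mul]
      have h2 : (e * d) * t = 0 := by rw [k2', mul_assoc, ht.lz, mul_zero]
      rw [mul_sub, sub_mul, h1, h2]; simpa using h t ht
  have k3' : d = e * d := sub_eq_zero.1 k3
  exact ⟨k3'.symm, by rw [k1', ← k2', ← k3']⟩

theorem T12 {d : R} (h : Ann e true false d) : d * e = e * d * e := by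
  have hi := g.idem
  have : d * e - e * d * e = 0 := by
    apply g.a1
    · simp [mul_sub, ← mul_assoc, hi]
    · intro t ht
      have := congrArg (· * e) (h t ht)
      simp only [add_mul, mul_assoc, ht.rz, mul_zero, add_zero, zero_mul] at this
      rw [mul_sub, ← mul_assoc t (e * d), ← mul_assoc t e d, ht.rz, this]; simp
  exact sub_eq_zero.1 this

theorem T21 {d : R} (h : Ann e false true d) : e * d = e * d * e := by
  have hi := g.idem
  have : e * d - e * d * e = 0 := by
    apply g.a2
    · simp [sub_mul, mul_assoc, hi]
    · intro t ht
      have := congrArg (e * ·) (h t ht)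
      simp only [mul_add, ← mul_assoc, ht.lz, zero_mul, zero_add, mul_zero] at this
      rw [sub_mul, mul_assoc (e * d) e t, ht.lz, this]; simp
  exact sub_eq_zero.1 this

theorem E_T22 {d : R} (h : e * d + d * e = 0) (h' : Ann e false false d) : d = 0 := by
  rw [← (g.T22 h').1, (g.E h).1]

theorem E_T12 {d : R} (h : e * d + d * e = 0) (h' : Ann e true false d) : d = 0 := by
  obtain ⟨h1, h2⟩ := g.E h
  apply g.a1 d h1
  intro t ht
  have := h' t ht
  rwa [show d * t = 0 by rw [← ht.le, ← mul_assoc, h2, zero_mul], add_zero] at this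

theorem E_T21 {d : R} (h : e * d + d * e = 0) (h' : Ann e false true d) : d = 0 := by
  obtain ⟨h1, h2⟩ := g.E h
  apply g.a2 d h2
  intro t ht
  have := h' t ht
  rwa [show t * d = 0 by rw [← ht.re, mul_assoc, h1, mul_zero], zero_add] at this

theorem T12_T22 {d : R} (h : Ann e true false d) (h' : Ann e false false d) : d = 0 := by
  obtain ⟨h1, h2⟩ := g.T22 h'
  apply g.b1 d h2
  intro t ht
  have := h t ht
  rwa [show t * d = 0 by rw [← h1, ← mul_assoc, ht.rz, zero_mul], zero_add] at this

end GoodIdem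

/-- Jordan type map. -/
structure JMap {R M : Type*} [NonUnitalRing R] [AddCommGroup M] (φ : R → M) : Prop where
  inj : Function.Injective φ
  surj : Function.Surjective φ
  lin : ∀ t, ∃ L : M →+ M, ∀ s, φ (t * s + s * t) = L (φ s)

namespace JMap
variable {R M : Type*} [NonUnitalRing R] [AddCommGroup M] {φ : R → M} {e : R}

theorem zero (h : JMap φ) : φ 0 = 0 := by
  obtain ⟨s, hs⟩ := h.surj 0
  obtain ⟨L, hL⟩ := h.lin 0
  have := hL s
  simpa [hs] using this

theorem k2 (h : JMap φ) {S a b : R} (hS : φ S = φ a + φ b) (t : R) :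
    φ (t * S + S * t) = φ (t * a + a * t) + φ (t * b + b * t) := by
  obtain ⟨L, hL⟩ := h.lin t
  simp [hL, hS]

theorem k3 (h : JMap φ) {S a b c : R} (hS : φ S = φ a + φ b + φ c) (t : R) :
    φ (t * S + S * t) = φ (t * a + a * t) + φ (t * b + b * t) + φ (t * c + c * t) := by
  obtain ⟨L, hL⟩ := h.lin t
  simp [hL, hS]

theorem k4 (h : JMap φ) {S a b c d : R} (hS : φ S = φ a + φ b + φ c + φ d) (t : R) :
    φ (t * S + S * t) = φ (t * a + a * t) + φ (t * b + b * t) + φ (t * c + c * t)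
      + φ (t * d + d * t) := by
  obtain ⟨L, hL⟩ := h.lin t
  simp [hL, hS]

theorem sub_ann {t S a : R} (h : t * S + S * t = t * a + a * t) :
    t * (S - a) + (S - a) * t = 0 := by
  rw [mul_sub, sub_mul, sub_add_sub_comm, h, sub_self]

variable (h : JMap φ) (g : GoodIdem e)
include g

theorem decomp_s17 (x : R) : ∃ a b c d, PC e true true a ∧ PC e true false b ∧ PC e false true c ∧
    PC e false false d ∧ x = a + b + c + d := by
  have hi := g.idem
  have hi' : ∀ y, e * (e * y) = e * y := fun y => by rw [← mul_assoc, hi]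
  refine ⟨e * x * e, e * x - e * x * e, x * e - e * x * e, x - e * x - x * e + e * x * e,
    ?_, ?_, ?_, ?_, by abel⟩ <;>
  refine ⟨?_, ?_⟩ <;> simp [mul_sub, sub_mul, mul_add, add_mul, mul_assoc, hi, hi']

include h

theorem add_11_22 {a b : R} (ha : PC e true true a) (hb : PC e false false b) :
    φ (a + b) = φ a + φ b := by
  obtain ⟨S, hS⟩ := h.surj (φ a + φ b)
  rw [← hS, ← sub_eq_zero.1 (g.E_T22 (d := S - (a + b)) (sub_ann (h.inj ?_)) fun t ht => sub_ann (h.inj ?_))]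
  · rw [h.k2 hS]
    simp [mul_add, add_mul, hb.lz, hb.rz, h.zero]
  · rw [h.k2 hS]
    simp [mul_add, add_mul, ht.ft ha, ha.tf ht, h.zero]

theorem add_11_12 {a b : R} (ha : PC e true true a) (hb : PC e true false b) :
    φ (a + b) = φ a + φ b := by
  obtain ⟨S, hS⟩ := h.surj (φ a + φ b)
  rw [← hS, ← sub_eq_zero.1 (g.T12_T22 (d := S - (a + b)) (fun t ht => sub_ann (h.inj ?_)) fun t ht => sub_ann (h.inj ?_))]
  · rw [h.k2 hS]
    simp [mul_add, add_mul, ht.ft hb, hb.ft ht, h.zero]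
  · rw [h.k2 hS]
    simp [mul_add, add_mul, ht.ft ha, ha.tf ht, h.zero]

theorem add_22_12 {a b : R} (ha : PC e false false a) (hb : PC e true false b) :
    φ (a + b) = φ a + φ b := by
  obtain ⟨S, hS⟩ := h.surj (φ a + φ b)
  rw [← hS, ← sub_eq_zero.1 (g.E_T12 (d := S - (a + b)) (sub_ann (h.inj ?_)) fun t ht => sub_ann (h.inj ?_))]
  · rw [h.k2 hS]
    simp [mul_add, add_mul, ha.lz, ha.rz, h.zero]
  · rw [h.k2 hS]
    simp [mul_add, add_mul, ht.ft hb, hb.ft ht, h.zero]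

theorem add_22_21 {a b : R} (ha : PC e false false a) (hb : PC e false true b) :
    φ (a + b) = φ a + φ b := by
  obtain ⟨S, hS⟩ := h.surj (φ a + φ b)
  rw [← hS, ← sub_eq_zero.1 (g.E_T21 (d := S - (a + b)) (sub_ann (h.inj ?_)) fun t ht => sub_ann (h.inj ?_))]
  · rw [h.k2 hS]
    simp [mul_add, add_mul, ha.lz, ha.rz, h.zero]
  · rw [h.k2 hS]
    simp [mul_add, add_mul, ht.tf hb, hb.tf ht, h.zero]

theorem add_12_12 {a b : R} (ha : PC e true false a) (hb : PC e true false b) :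
    φ (a + b) = φ a + φ b := by
  obtain ⟨f, hf, hfa⟩ := g.e1 a ha
  have := h.k2 (h.add_22_12 g hf hb) (e + a)
  simpa [mul_add, add_mul, hf.lz, hf.rz, hb.le, hb.rz, hfa, hf.ft ha, ha.ft hb, hb.ft ha] using this

theorem add_21_21 {a b : R} (ha : PC e false true a) (hb : PC e false true b) :
    φ (a + b) = φ a + φ b := by
  obtain ⟨f, hf, hfa⟩ := g.e2 a ha
  have := h.k2 (h.add_22_21 g hf hb) (e + a)
  rw [add_comm a b]
  simpa [mul_add, add_mul, hf.lz, hf.rz, hb.re, hb.lz, hfa, ha.tf hf, ha.tf hb, hb.tf ha] using this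

theorem add_12_21 {a b : R} (ha : PC e true false a) (hb : PC e false true b) :
    φ (a + b) = φ a + φ b := by
  obtain ⟨S, hS⟩ := h.surj (φ a + φ b)
  have h1 : e * S + S * e = S := h.inj (by
    rw [h.k2 hS, hS]; simp [ha.le, ha.rz, hb.lz, hb.re])
  have h2 : GoodIdem.Ann e true false (S - (a + b)) := fun t ht => sub_ann (h.inj (by
    rw [h.k2 hS]; simp [mul_add, add_mul, ht.ft ha, ha.ft ht, h.zero]))
  have h3 : GoodIdem.Ann e false true (S - (a + b)) := fun t ht => sub_ann (h.inj (by
    rw [h.k2 hS]; simp [mul_add, add_mul, ht.tf hb, hb.tf ht, h.zero]))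
  have h4 : e * (S - (a + b)) + (S - (a + b)) * e = S - (a + b) := by
    rw [mul_sub, sub_mul, sub_add_sub_comm, h1]
    simp [mul_add, add_mul, ha.le, ha.rz, hb.lz, hb.re]
  have h5 := g.T12 h2
  have h6 := g.T21 h3
  rw [← hS]
  suffices h0 : S - (a + b) = 0 by rw [sub_eq_zero.1 h0]
  clear h2 h3
  generalize S - (a + b) = d at *
  have h7 : e * d * e = 0 := by
    have := congrArg (e * ·) h4
    simpa [mul_add, ← mul_assoc, g.idem] using this
  rw [← h4, h5, h7, h6, h7, add_zero]

theorem add_11_11 {a b : R} (ha : PC e true true a) (hb : PC e true true b) :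
    φ (a + b) = φ a + φ b := by
  obtain ⟨S, hS⟩ := h.surj (φ a + φ b)
  rw [← hS, ← sub_eq_zero.1 (g.T12_T22 (d := S - (a + b)) (fun t ht => sub_ann (h.inj ?_)) fun t ht => sub_ann (h.inj ?_))]
  · rw [h.k2 hS]
    simp [mul_add, add_mul, ht.ft ha, ht.ft hb, h.add_12_12 g (ha.mul ht) (hb.mul ht)]
  · rw [h.k2 hS]
    simp [mul_add, add_mul, ht.ft ha, ha.tf ht, ht.ft hb, hb.tf ht, h.zero]

theorem add_22_22 {a b : R} (ha : PC e false false a) (hb : PC e false false b) :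
    φ (a + b) = φ a + φ b := by
  obtain ⟨S, hS⟩ := h.surj (φ a + φ b)
  rw [← hS, ← sub_eq_zero.1 (g.E_T12 (d := S - (a + b)) (sub_ann (h.inj ?_)) fun t ht => sub_ann (h.inj ?_))]
  · rw [h.k2 hS]
    simp [mul_add, add_mul, ha.lz, ha.rz, hb.lz, hb.rz, h.zero]
  · rw [h.k2 hS]
    simp [mul_add, add_mul, ha.ft ht, hb.ft ht, h.add_12_12 g (ht.mul ha) (ht.mul hb)]

theorem add_11_12_22 {a b c : R} (ha : PC e true true a) (hb : PC e true false b)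
    (hc : PC e false false c) : φ (a + b + c) = φ a + φ b + φ c := by
  obtain ⟨S, hS⟩ := h.surj (φ a + φ b + φ c)
  rw [← hS, ← sub_eq_zero.1 (g.E_T22 (d := S - (a + b + c)) (sub_ann (h.inj ?_)) fun t ht => sub_ann (h.inj ?_))]
  · rw [h.k3 hS]
    simp [mul_add, add_mul, ha.le, ha.re, hb.le, hb.rz, hc.lz, hc.rz, h.zero]
    rw [← h.add_11_12 g (ha.add ha) hb]; congr 1; abel
  · rw [h.k3 hS]
    simp [mul_add, add_mul, ht.ft ha, ha.tf ht, ht.ft hb, h.zero]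
    rw [add_comm (φ (b * t)), ← h.add_22_12 g ((ht.mul hc).add (hc.mul ht)) (hb.mul ht)]
    congr 1; abel

theorem add_11_12_21 {a b c : R} (ha : PC e true true a) (hb : PC e true false b)
    (hc : PC e false true c) : φ (a + b + c) = φ a + φ b + φ c := by
  obtain ⟨S, hS⟩ := h.surj (φ a + φ b + φ c)
  rw [← hS, ← sub_eq_zero.1 (g.T12_T22 (d := S - (a + b + c)) (fun t ht => sub_ann (h.inj ?_)) fun t ht => sub_ann (h.inj ?_))]
  · rw [h.k3 hS]
    simp [mul_add, add_mul, ht.ft ha, ht.ft hb, hb.ft ht, h.zero]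
    rw [h.add_11_22 g (ht.mul hc) (hc.mul ht), ← add_assoc, add_comm (φ (a * t)),
      ← h.add_11_12_22 g (ht.mul hc) (ha.mul ht) (hc.mul ht)]
    congr 1; abel
  · rw [h.k3 hS]
    simp [mul_add, add_mul, ht.ft ha, ha.tf ht, ht.ft hb, hc.tf ht, h.zero]
    rw [← h.add_12_21 g (hb.mul ht) (ht.mul hc)]
    congr 1; abel

theorem add_all {a b c d : R} (ha : PC e true true a) (hb : PC e true false b)
    (hc : PC e false true c) (hd : PC e false false d) :
    φ (a + b + c + d) = φ a + φ b + φ c + φ d := by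
  obtain ⟨S, hS⟩ := h.surj (φ a + φ b + φ c + φ d)
  rw [← hS, ← sub_eq_zero.1 (g.E_T12 (d := S - (a + b + c + d)) (sub_ann (h.inj ?_)) fun t ht => sub_ann (h.inj ?_))]
  · rw [h.k4 hS]
    simp [mul_add, add_mul, ha.le, ha.re, hb.le, hb.rz, hc.lz, hc.re, hd.lz, hd.rz, h.zero]
    rw [← h.add_11_12_21 g (ha.add ha) hb hc]; congr 1; abel
  · rw [h.k4 hS]
    simp [mul_add, add_mul, ht.ft ha, ht.ft hb, hb.ft ht, hd.ft ht, h.zero]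
    rw [h.add_11_22 g (ht.mul hc) (hc.mul ht)]
    have h1 := h.add_12_12 g (ha.mul ht) (ht.mul hd)
    have h2 := h.add_11_12_22 g (ht.mul hc) ((ha.mul ht).add (ht.mul hd)) (hc.mul ht)
    rw [h1] at h2
    have h3 : φ (a * t) + (φ (t * c) + φ (c * t)) + φ (t * d)
        = φ (t * c) + (φ (a * t) + φ (t * d)) + φ (c * t) := by abel
    rw [h3, ← h2]
    congr 1; abel

theorem map_add (x y : R) : φ (x + y) = φ x + φ y := by
  obtain ⟨a, b, c, d, ha, hb, hc, hd, rfl⟩ := decomp_s17 g x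
  obtain ⟨a', b', c', d', ha', hb', hc', hd', rfl⟩ := decomp_s17 g y
  have : a + b + c + d + (a' + b' + c' + d') = (a + a') + (b + b') + (c + c') + (d + d') := by abel
  rw [this, h.add_all g (ha.add ha') (hb.add hb') (hc.add hc') (hd.add hd'),
    h.add_all g ha hb hc hd, h.add_all g ha' hb' hc' hd', h.add_11_11 g ha ha',
    h.add_12_12 g hb hb', h.add_21_21 g hc hc', h.add_22_22 g hd hd']
  abel

end JMap


section Concrete

variable {X : Type*} [NormedAddCommGroup X] [NormedSpace ℂ X]
  (𝒜 : NonUnitalSubalgebra ℂ (X →L[ℂ] X))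

theorem smulRight_mem
    (h𝒜 : ∀ T : X →L[ℂ] X, FiniteDimensional ℂ (LinearMap.range (T : X →ₗ[ℂ] X)) → T ∈ 𝒜)
    (g : X →L[ℂ] ℂ) (v : X) : g.smulRight v ∈ 𝒜 := by
  apply h𝒜
  have : LinearMap.range ((g.smulRight v : X →L[ℂ] X) : X →ₗ[ℂ] X) ≤ Submodule.span ℂ {v} := by
    rintro _ ⟨w, rfl⟩
    exact Submodule.smul_mem _ _ (Submodule.mem_span_singleton_self v)
  exact Submodule.finiteDimensional_of_le this

theorem ext_pt {A B : 𝒜} : A = B ↔ ∀ w, (A : X →L[ℂ] X) w = (B : X →L[ℂ] X) w := by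
  rw [Subtype.ext_iff, ContinuousLinearMap.ext_iff]

theorem exists_good (hX : 1 < Module.rank ℂ X)
    (h𝒜 : ∀ T : X →L[ℂ] X, FiniteDimensional ℂ (LinearMap.range (T : X →ₗ[ℂ] X)) → T ∈ 𝒜) :
    ∃ e : 𝒜, GoodIdem e := by
  have hnt : Nontrivial X := by
    rw [← rank_pos_iff_nontrivial (R := ℂ)]
    exact lt_trans zero_lt_one hX
  obtain ⟨u, hu⟩ := exists_ne (0 : X)
  obtain ⟨f, hf⟩ := SeparatingDual.exists_eq_one (R := ℂ) hu
  obtain ⟨v, hv, hfv⟩ : ∃ v : X, v ≠ 0 ∧ f v = 0 := by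
    by_contra! hcon
    apply not_le_of_gt hX
    rw [rank_le_one_iff]
    refine ⟨u, fun w => ⟨f w, ?_⟩⟩
    by_contra hw
    refine hcon (w - f w • u) (fun h0 => hw (sub_eq_zero.1 h0).symm) ?_
    simp [hf]
  have sep : ∀ z : X, z ≠ 0 → f z = 0 → ∃ k : X →L[ℂ] ℂ, k z = 1 ∧ k u = 0 := by
    intro z hz hfz
    obtain ⟨k, hk⟩ := SeparatingDual.exists_eq_one (R := ℂ) hz
    exact ⟨k - k u • f, by simp [hk, hfz], by simp [hf]⟩
  let Rk : (X →L[ℂ] ℂ) → X → 𝒜 := fun k z => ⟨k.smulRight z, smulRight_mem 𝒜 h𝒜 k z⟩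
  have hR : ∀ k z w, (Rk k z : X →L[ℂ] X) w = k w • z := fun k z w => rfl
  have mulv : ∀ (A B : 𝒜) (w : X), ((A * B : 𝒜) : X →L[ℂ] X) w
    = (A : X →L[ℂ] X) ((B : X →L[ℂ] X) w) := fun _ _ _ => rfl
  have addv : ∀ (A B : 𝒜) (w : X), ((A + B : 𝒜) : X →L[ℂ] X) w
    = (A : X →L[ℂ] X) w + (B : X →L[ℂ] X) w := fun _ _ _ => rfl
  have zerov : ∀ (w : X), ((0 : 𝒜) : X →L[ℂ] X) w = 0 := fun _ => rfl
  have p12 : ∀ k, k u = 0 → PC (Rk f u) true false (Rk k u) := by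
    intro k hk
    constructor <;> simp [ext_pt, mulv, hR, hf, hk]
  have p21 : ∀ z, f z = 0 → PC (Rk f u) false true (Rk f z) := by
    intro z hz
    constructor <;> simp [ext_pt, mulv, hR, hf, hz]
  have p22 : ∀ k z, k u = 0 → f z = 0 → PC (Rk f u) false false (Rk k z) := by
    intro k z hk hz
    constructor <;> simp [ext_pt, mulv, hR, hf, hz, hk]
  have lz : ∀ x : 𝒜, Rk f u * x = 0 → ∀ w, f ((x : X →L[ℂ] X) w) = 0 := by
    intro x hx w
    have := (ext_pt 𝒜).1 hx w
    simpa [mulv, hR, hu] using this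
  have rz : ∀ x : 𝒜, x * Rk f u = 0 → (x : X →L[ℂ] X) u = 0 := by
    intro x hx
    have := (ext_pt 𝒜).1 hx u
    simpa [mulv, hR, hf] using this
  have le : ∀ x : 𝒜, Rk f u * x = x →
      ∀ w, f ((x : X →L[ℂ] X) w) • u = (x : X →L[ℂ] X) w := by
    intro x hx w
    have := (ext_pt 𝒜).1 hx w
    simpa [mulv, hR] using this
  have re : ∀ x : 𝒜, x * Rk f u = x →
      ∀ w, f w • (x : X →L[ℂ] X) u = (x : X →L[ℂ] X) w := by
    intro x hx w
    have := (ext_pt 𝒜).1 hx w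
    simpa [mulv, hR] using this
  -- reduction to vectors in the kernel of `f`
  have red : ∀ x : 𝒜, x * Rk f u = 0 →
      (∀ z, f z = 0 → (x : X →L[ℂ] X) z = 0) → x = 0 := by
    intro x hx hz
    rw [ext_pt]
    intro w
    have := hz (w - f w • u) (by simp [hf])
    simpa [rz x hx] using this
  refine ⟨Rk f u, ?_⟩
  constructor
  · intro x hx
    rw [ext_pt] at hx ⊢
    intro w
    have := hx w
    rw [addv, zerov] at this
    rw [zerov]
    rw [← two_smul ℂ] at this
    exact (smul_eq_zero.1 this).resolve_left two_ne_zero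
  · simp [ext_pt, mulv, hR, hf]
  · intro x hx ht
    rw [ext_pt]; intro w
    by_contra hw
    obtain ⟨k, hk, hku⟩ := sep _ hw (lz x hx w)
    have := (ext_pt 𝒜).1 (ht _ (p12 k hku)) w
    simp [mulv, hR, hk, hu] at this
  · intro x hx ht
    refine red x hx fun z hz => ?_
    have := (ext_pt 𝒜).1 (ht _ (p21 z hz)) u
    simpa [mulv, hR, hf] using this
  · intro x hx ht
    obtain ⟨k, hk, hku⟩ := sep v hv hfv
    have := (ext_pt 𝒜).1 (ht _ (p12 k hku)) v
    simp only [mulv, hR, hk, one_smul, zerov] at this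
    rw [ext_pt]; intro w
    rw [← re x hx w, this]; simp
  · intro x hx ht
    rw [ext_pt]; intro w
    by_contra hw
    obtain ⟨k, hk, hku⟩ := sep _ hw (lz x hx w)
    have := (ext_pt 𝒜).1 (ht _ (p22 k _ hku (lz x hx w))) w
    simp only [mulv, hR, hk, one_smul, zerov] at this
    exact hw this
  · intro x hx ht
    refine red x hx fun z hz => ?_
    by_cases hz0 : z = 0
    · simp [hz0]
    obtain ⟨k, hk, hku⟩ := sep _ hz0 hz
    have := (ext_pt 𝒜).1 (ht _ (p22 k _ hku hz)) z
    simpa only [mulv, hR, hk, one_smul, zerov] using this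
  · intro x hx ht
    refine red x hx.rz fun z hz => ?_
    by_cases hz0 : z = 0
    · simp [hz0]
    obtain ⟨k, hk, hku⟩ := sep _ hz0 hz
    have := (ext_pt 𝒜).1 (ht _ (p22 k _ hku hz)) z
    simp only [addv, mulv, hR, hk, one_smul, zerov] at this
    have h2 := congrArg k this
    simp [hk] at h2
    simpa [h2] using this
  · intro a ha
    by_cases h0 : ∀ w, f ((a : X →L[ℂ] X) w) = 0
    · refine ⟨0, by constructor <;> simp, ?_⟩
      rw [ext_pt]; intro w
      rw [← le a ha.le w, h0]; simp
    · push Not at h0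
      obtain ⟨w, hw⟩ := h0
      set c := f ((a : X →L[ℂ] X) w) with hc
      refine ⟨Rk (f.comp (a : X →L[ℂ] X)) (c⁻¹ • (w - f w • u)), p22 _ _ ?_ ?_, ?_⟩
      · simp [rz a ha.rz]
      · simp [hf]
      · rw [ext_pt]; intro y
        have h1 := le a ha.le w
        rw [← hc] at h1
        simp only [mulv, hR, map_smul, map_sub, rz a ha.rz, smul_zero, sub_zero, ← h1]
        rw [smul_smul c⁻¹, inv_mul_cancel₀ hw, one_smul]
        exact le a ha.le y
  · intro a ha
    by_cases h0 : (a : X →L[ℂ] X) u = 0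
    · refine ⟨0, by constructor <;> simp, ?_⟩
      rw [ext_pt]; intro w
      rw [← re a ha.re w, h0]; simp
    · obtain ⟨k, hk, hku⟩ := sep _ h0 (lz a ha.lz u)
      refine ⟨Rk k ((a : X →L[ℂ] X) u), p22 _ _ hku (lz a ha.lz u), ?_⟩
      rw [ext_pt]; intro w
      rw [mulv, hR, ← re a ha.re w]
      simp [hk]

end Concrete



theorem jordan_map_additive_on_finite_rank
    {X Y : Type*} [NormedAddCommGroup X] [NormedSpace ℂ X] [CompleteSpace X]
    [NormedAddCommGroup Y] [NormedSpace ℂ Y] [CompleteSpace Y]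
    (hX : 1 < Module.rank ℂ X)
    (𝒜 : NonUnitalSubalgebra ℂ (X →L[ℂ] X)) (ℬ : NonUnitalSubalgebra ℂ (Y →L[ℂ] Y))
    (h𝒜 : ∀ T : X →L[ℂ] X, FiniteDimensional ℂ (LinearMap.range (T : X →ₗ[ℂ] X)) → T ∈ 𝒜)
    (hℬ : ∀ S : Y →L[ℂ] Y, FiniteDimensional ℂ (LinearMap.range (S : Y →ₗ[ℂ] Y)) → S ∈ ℬ)
    (φ : 𝒜 → ℬ) (hbij : Function.Bijective φ)
    (hJ : ∀ A B : 𝒜, φ (((1:ℂ)/2) • (A * B + B * A))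
        = ((1:ℂ)/2) • (φ A * φ B + φ B * φ A)) :
    ∀ A B : 𝒜, FiniteDimensional ℂ (LinearMap.range ((A : X →L[ℂ] X) : X →ₗ[ℂ] X)) →
      FiniteDimensional ℂ (LinearMap.range ((B : X →L[ℂ] X) : X →ₗ[ℂ] X)) →
      φ (A + B) = φ A + φ B := by
  intro A B _ _
  obtain ⟨e, he⟩ := exists_good 𝒜 hX h𝒜
  refine JMap.map_add (φ := φ) ⟨hbij.1, hbij.2, fun t => ?_⟩ he A B
  refine ⟨((1:ℂ)/2) • (AddMonoidHom.mulLeft (φ ((2:ℂ) • t))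
    + AddMonoidHom.mulRight (φ ((2:ℂ) • t))), fun s => ?_⟩
  have := hJ ((2:ℂ) • t) s
  have h2 : ((1:ℂ)/2) • (((2:ℂ) • t) * s + s * ((2:ℂ) • t)) = t * s + s * t := by
    rw [smul_mul_assoc, mul_smul_comm, ← smul_add, smul_smul]; norm_num
  rw [h2] at this
  rw [this]
  rfl
end

section
/- Let H be a complex Hilbert space, let 𝒜 ⊆ B(H) be a standard operator algebra which is closed under taking adjoints, let A ∈ 𝒜 be a positive operator and let n be a positive integer. Then A has rank n (i.e. the range of A is n-dimensional) if and only if there exists a system A₁, …, Aₙ ∈ 𝒜 of nonzero positive operators such that the closure of the range of Aₖ is contained in the closure of the range of A for k = 1, …, n and AₖAₗ = 0 for k ≠ l, but there is no such system of n+1 members. -/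
open scoped ComplexOrder

/-- A system of `m` members exists iff `m` is at most the rank of `A`. -/
theorem system_iff_le_rank
    {H : Type*} [NormedAddCommGroup H] [InnerProductSpace ℂ H] [CompleteSpace H]
    (𝒜 : NonUnitalSubalgebra ℂ (H →L[ℂ] H))
    (h𝒜 : ∀ T : H →L[ℂ] H, FiniteDimensional ℂ (LinearMap.range (T : H →ₗ[ℂ] H)) → T ∈ 𝒜)
    (A : H →L[ℂ] H) (m : ℕ) :
    (∃ B : Fin m → H →L[ℂ] H, (∀ k, B k ∈ 𝒜) ∧ (∀ k, B k ≠ 0) ∧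
          (∀ k, ∀ x : H, 0 ≤ (inner ℂ (B k x) x : ℂ)) ∧
          (∀ k, closure (Set.range (B k)) ⊆ closure (Set.range A)) ∧
          (∀ k l, k ≠ l → B k * B l = 0)) ↔
      (m : Cardinal) ≤ Module.rank ℂ (LinearMap.range (A : H →ₗ[ℂ] H)) := by
  constructor
  · rintro ⟨B, -, h0, hpos, hcl, horth⟩
    by_cases hfin : FiniteDimensional ℂ (LinearMap.range (A : H →ₗ[ℂ] H))
    · have hclosed : IsClosed (Set.range A) :=
        Submodule.closed_of_finiteDimensional (LinearMap.range (A : H →ₗ[ℂ] H))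
      have hx : ∀ k, ∃ x, B k x ≠ 0 := by
        intro k
        by_contra! h
        exact h0 k (ContinuousLinearMap.ext h)
      choose x hx using hx
      have hmem : ∀ k, B k (x k) ∈ LinearMap.range (A : H →ₗ[ℂ] H) := by
        intro k
        have := hcl k (subset_closure (Set.mem_range_self (x k)))
        rw [hclosed.closure_eq] at this
        exact this
      have hsa : ∀ k, ∀ u v : H, inner ℂ (B k u) v = inner ℂ u (B k v) := by
        intro k
        have hp : (B k : H →ₗ[ℂ] H).IsPositive := by
          rw [LinearMap.isPositive_iff_complex]
          intro u
          have := Complex.le_def.1 (hpos k u)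
          refine ⟨?_, this.1⟩
          apply Complex.ext
          · simp
          · simpa using this.2
        exact hp.isSymmetric
      have hli : LinearIndependent ℂ (fun k => B k (x k)) := by
        apply linearIndependent_of_ne_zero_of_inner_eq_zero hx
        intro k l hkl
        change inner ℂ (B k (x k)) (B l (x l)) = 0
        rw [hsa]
        have := congrArg (fun T : H →L[ℂ] H => T (x l)) (horth k l hkl)
        simp only [ContinuousLinearMap.mul_apply, ContinuousLinearMap.zero_apply] at this
        rw [this, inner_zero_right]
      have hli' : LinearIndependent ℂ
          (fun k => (⟨B k (x k), hmem k⟩ : LinearMap.range (A : H →ₗ[ℂ] H))) :=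
        LinearIndependent.of_comp (LinearMap.range (A : H →ₗ[ℂ] H)).subtype hli
      have := hli'.cardinal_lift_le_rank
      simpa using this
    · have : Cardinal.aleph0 ≤ Module.rank ℂ (LinearMap.range (A : H →ₗ[ℂ] H)) := by
        by_contra! h
        exact hfin (Module.rank_lt_aleph0_iff.1 h)
      exact (Cardinal.natCast_lt_aleph0.le).trans this
  · intro h
    obtain ⟨s, hs, hli⟩ := le_rank_iff_exists_linearIndependent_finset.1 h
    let e : Fin m ≃ s := (Fintype.equivFinOfCardEq (by simpa using hs)).symm
    have hli2 : LinearIndependent ℂ (fun k => ((e k : LinearMap.range (A : H →ₗ[ℂ] H)))) :=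
      hli.comp e e.injective
    let v := InnerProductSpace.gramSchmidtNormed ℂ
      (fun k => ((e k : LinearMap.range (A : H →ₗ[ℂ] H))))
    have hv : Orthonormal ℂ v := InnerProductSpace.gramSchmidtNormed_orthonormal hli2
    have hn : ∀ k, (v k : H) ≠ 0 := by
      intro k hk
      exact hv.ne_zero k (Subtype.ext hk)
    refine ⟨fun k => InnerProductSpace.rankOne ℂ (v k : H) (v k : H), ?_, ?_, ?_, ?_, ?_⟩
    · intro k
      apply h𝒜
      refine Submodule.finiteDimensional_of_le (S₂ := Submodule.span ℂ {(v k : H)}) ?_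
      rintro _ ⟨y, rfl⟩
      exact Submodule.smul_mem _ _ (Submodule.mem_span_singleton_self _)
    · intro k hk
      have := congrArg (fun T : H →L[ℂ] H => T (v k)) hk
      simp [InnerProductSpace.rankOne_apply] at this
      exact hv.ne_zero k this
    · intro k y
      rw [InnerProductSpace.rankOne_apply, inner_smul_left, mul_comm]
      exact mul_star_self_nonneg _
    · intro k
      apply closure_mono
      rintro _ ⟨y, rfl⟩
      exact (LinearMap.range (A : H →ₗ[ℂ] H)).smul_mem _ (v k).2
    · intro k l hkl
      have h0 : inner ℂ (v k : H) (v l : H) = 0 := hv.2 hkl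
      ext y
      simp [InnerProductSpace.rankOne_apply, inner_smul_right, h0]

/-- A positive element `A` of a standard operator algebra (closed under adjoints) on a
complex Hilbert space has rank `n` iff there is a system of `n` nonzero positive
operators in the algebra, mutually annihilating, whose range closures are contained in
the range closure of `A`, but no such system of `n+1` members. -/
theorem positive_rank_iff_orthogonal_positive_system
    {H : Type*} [NormedAddCommGroup H] [InnerProductSpace ℂ H] [CompleteSpace H]
    (𝒜 : NonUnitalSubalgebra ℂ (H →L[ℂ] H))
    (h𝒜 : ∀ T : H →L[ℂ] H, FiniteDimensional ℂ (LinearMap.range (T : H →ₗ[ℂ] H)) → T ∈ 𝒜)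
    (h𝒜star : ∀ T ∈ 𝒜, ContinuousLinearMap.adjoint T ∈ 𝒜)
    (A : H →L[ℂ] H) (hA𝒜 : A ∈ 𝒜)
    (hA : ∀ x : H, 0 ≤ (inner ℂ (A x) x : ℂ)) (n : ℕ) (hn : 0 < n) :
    Module.finrank ℂ (LinearMap.range (A : H →ₗ[ℂ] H)) = n ↔
      ((∃ B : Fin n → H →L[ℂ] H, (∀ k, B k ∈ 𝒜) ∧ (∀ k, B k ≠ 0) ∧
          (∀ k, ∀ x : H, 0 ≤ (inner ℂ (B k x) x : ℂ)) ∧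
          (∀ k, closure (Set.range (B k)) ⊆ closure (Set.range A)) ∧
          (∀ k l, k ≠ l → B k * B l = 0)) ∧
        ¬ (∃ B : Fin (n + 1) → H →L[ℂ] H, (∀ k, B k ∈ 𝒜) ∧ (∀ k, B k ≠ 0) ∧
          (∀ k, ∀ x : H, 0 ≤ (inner ℂ (B k x) x : ℂ)) ∧
          (∀ k, closure (Set.range (B k)) ⊆ closure (Set.range A)) ∧
          (∀ k l, k ≠ l → B k * B l = 0))) := by
  rw [system_iff_le_rank 𝒜 h𝒜 A n, system_iff_le_rank 𝒜 h𝒜 A (n + 1), Module.finrank,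
    Cardinal.toNat_eq_iff hn.ne', not_le]
  constructor
  · intro h
    rw [h]
    exact ⟨le_rfl, by exact_mod_cast Nat.lt_succ_self n⟩
  · rintro ⟨h1, h2⟩
    refine le_antisymm ?_ h1
    rw [Nat.cast_succ, ← Cardinal.succ_natCast] at h2
    exact Order.lt_succ_iff.1 h2
end
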